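/- arXiv:2308.08768 — 4 statements merged into one kernel-verified Lean document; each statement's English description precedes it below -/
import Mathlib

section
/- Let G be a finite simple graph that is (P3∪P2)-free, W4-free, K4-free, (P2∪K3)-free, F1-free and F2-free. If G contains an induced subgraph isomorphic to F3, then χ(G) ≤ 6. -/
open SimpleGraph

/-- `P3 ∪ P2`: disjoint union of a path on 3 vertices (0-1-2) and an edge (3-4). -/
def P3P2 : SimpleGraph (Fin 5) :=
  SimpleGraph.fromEdgeSet {s(0,1), s(1,2), s(3,4)}

/-- `W4`: wheel on 5 vertices; 4-cycle 0-1-2-3-0 plus hub 4 adjacent to all. -/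
def W4 : SimpleGraph (Fin 5) :=
  SimpleGraph.fromEdgeSet {s(0,1), s(1,2), s(2,3), s(3,0), s(4,0), s(4,1), s(4,2), s(4,3)}

/-- `P2 ∪ K3`: disjoint union of an edge (0-1) and a triangle (2,3,4). -/
def P2K3 : SimpleGraph (Fin 5) :=
  SimpleGraph.fromEdgeSet {s(0,1), s(2,3), s(3,4), s(2,4)}

/-- `F1`: 6-cycle v1 v2 u2 u1 u3 v3 (= 0 1 2 3 4 5) plus edges v2v3 (1-5) and u2u3 (2-4). -/
def F1 : SimpleGraph (Fin 6) :=
  SimpleGraph.fromEdgeSet {s(0,1), s(1,2), s(2,3), s(3,4), s(4,5), s(5,0), s(1,5), s(2,4)}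

/-- `F2`: 5-cycle v1 v2 u3 u1 u2 (= 0 1 2 3 4) plus a vertex u4 (= 5) adjacent to u1, u2, u3. -/
def F2 : SimpleGraph (Fin 6) :=
  SimpleGraph.fromEdgeSet {s(0,1), s(1,2), s(2,3), s(3,4), s(4,0), s(5,2), s(5,3), s(5,4)}

/-- `F3`: 6-cycle v1 v2 u2 u1 u3 v3 (= 0 1 2 3 4 5) plus the edge v2v3 (1-5). -/
def F3 : SimpleGraph (Fin 6) :=
  SimpleGraph.fromEdgeSet {s(0,1), s(1,2), s(2,3), s(3,4), s(4,5), s(5,0), s(1,5)}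

namespace FreeGraphs

/-- Neighbourhood rows of `F3` (bit `j` of row `i` is adjacency of `i` and `j`). -/
def f3Row (i : ℕ) : ℕ := [34, 37, 10, 20, 40, 19].getD i 0

/-- Bit rows of the forbidden patterns; pattern 2 is the complete graph on 4 vertices. -/
def patRow (k i : ℕ) : ℕ :=
  ([[2, 5, 2, 16, 8], [26, 21, 26, 21, 15], [14, 13, 11, 7], [2, 1, 24, 20, 12], [34, 37, 26, 20, 44, 19], [18, 5, 42, 52, 41, 28]].getD k []).getD i 0

/-- Number of vertices of the forbidden patterns. -/
def patSize (k : ℕ) : ℕ := [5, 5, 4, 5, 6, 6].getD k 0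

/-- Adjacency of the copy of `F3` (0-5) with two adjacent vertices 6, 7
whose neighbourhoods in the copy are given by the bits of `s` and `t`. -/
def mat (s t i j : ℕ) : Bool :=
  if i < 6 then
    if j < 6 then (f3Row i).testBit j else if j = 6 then s.testBit i else t.testBit i
  else if j < 6 then (if i = 6 then s.testBit j else t.testBit j)
  else i != j

/-- The vertices listed in `l` (all `< n`) induce the forbidden pattern `k`. -/
def Bad (n s t k : ℕ) (l : List ℕ) : Prop :=
  k < 6 ∧ ∀ i < patSize k, l.getD i 0 < n ∧ ∀ j < patSize k,
    (l.getD i 0 = l.getD j 0 → i = j) ∧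
      (patRow k i).testBit j = mat s t (l.getD i 0) (l.getD j 0)

instance (n s t k : ℕ) (l : List ℕ) : Decidable (Bad n s t k l) := by
  unfold Bad; infer_instance

/-- The possible neighbourhoods in the copy of `F3` of a vertex outside it. -/
def good : List ℕ := [0, 9, 18, 21, 23, 27, 31, 36, 42, 45, 46, 53, 54, 58, 61, 62]

/-- The colour of a vertex with given neighbourhood in the copy of `F3`. -/
def col (s : ℕ) : Fin 6 :=
  [0, 0, 0, 0, 0, 0, 0, 0, 0, 0, 0, 0, 0, 0, 0, 0, 0, 0, 1, 4, 2, 4, 0, 3, 0, 0, 0, 3, 0, 0, 0, 3,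
   0, 0, 1, 0, 2, 2, 0, 0, 0, 0, 3, 0, 0, 3, 3, 0, 0, 0, 0, 0, 0, 3, 1, 0, 0, 0, 1, 0, 0, 3, 1, 0].getD s 0

/-- Forbidden subgraphs for impossible neighbourhoods. -/
def cert1 : List (ℕ × List ℕ) :=
  [(9, []), (0, [1, 0, 6, 3, 4]), (0, [0, 1, 6, 3, 4]), (0, [2, 3, 4, 0, 6]),
   (0, [3, 2, 6, 0, 5]), (0, [1, 0, 6, 3, 4]), (0, [0, 1, 6, 3, 4]), (3, [3, 4, 0, 1, 6]),
   (0, [4, 3, 6, 0, 1]), (9, []), (0, [2, 3, 6, 0, 5]), (5, [3, 4, 5, 0, 6, 1]),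
   (0, [4, 3, 6, 0, 1]), (4, [3, 2, 1, 5, 0, 6]), (0, [0, 5, 4, 2, 6]), (5, [3, 4, 5, 0, 6, 1]),
   (0, [0, 1, 2, 4, 6]), (0, [5, 0, 6, 2, 3]), (9, []), (0, [5, 0, 6, 2, 3]),
   (0, [3, 4, 6, 0, 1]), (9, []), (0, [3, 2, 6, 0, 5]), (9, []),
   (0, [0, 1, 2, 4, 6]), (4, [1, 0, 6, 3, 4, 5]), (0, [2, 3, 6, 0, 5]), (9, []),
   (3, [0, 1, 3, 4, 6]), (4, [3, 2, 1, 5, 0, 6]), (3, [0, 5, 2, 3, 6]), (9, []),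
   (0, [0, 5, 6, 2, 3]), (0, [1, 0, 6, 3, 4]), (0, [0, 1, 6, 3, 4]), (0, [2, 3, 4, 0, 6]),
   (9, []), (0, [1, 0, 6, 3, 4]), (0, [0, 1, 6, 3, 4]), (2, [0, 1, 5, 6]),
   (0, [4, 3, 6, 0, 1]), (5, [2, 3, 6, 0, 1, 5]), (9, []), (2, [0, 1, 5, 6]),
   (0, [4, 3, 6, 0, 1]), (9, []), (9, []), (2, [0, 1, 5, 6]),
   (0, [0, 1, 2, 4, 6]), (3, [2, 3, 0, 5, 6]), (0, [0, 5, 6, 2, 3]), (2, [0, 1, 5, 6]),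
   (0, [3, 4, 6, 0, 1]), (9, []), (9, []), (2, [0, 1, 5, 6]),
   (0, [0, 1, 2, 4, 6]), (5, [2, 3, 6, 0, 1, 5]), (9, []), (2, [0, 1, 5, 6]),
   (3, [0, 1, 3, 4, 6]), (9, []), (9, []), (2, [0, 1, 5, 6])]

/-- Forbidden subgraphs for adjacent outside vertices of the same colour. -/
def cert2 : List (ℕ × ℕ × ℕ × List ℕ) :=
  [(0, 0, 0, [0, 1, 2, 6, 7]), (0, 9, 0, [2, 1, 5, 6, 7]), (9, 9, 0, [2, 1, 5, 6, 7]),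
   (18, 18, 5, [2, 3, 4, 6, 1, 7]), (18, 54, 1, [1, 5, 4, 6, 7]), (18, 58, 1, [1, 5, 4, 6, 7]),
   (18, 62, 1, [1, 5, 4, 6, 7]), (21, 21, 5, [1, 5, 4, 6, 2, 7]), (23, 23, 2, [0, 1, 6, 7]),
   (23, 27, 2, [0, 1, 6, 7]), (23, 31, 1, [2, 3, 4, 6, 7]), (23, 42, 1, [0, 5, 7, 6, 1]),
   (23, 45, 1, [0, 1, 2, 7, 6]), (23, 46, 1, [0, 5, 7, 6, 1]), (23, 53, 1, [0, 1, 2, 7, 6]),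
   (23, 61, 1, [0, 1, 2, 7, 6]), (27, 27, 2, [0, 1, 6, 7]), (27, 31, 1, [1, 2, 3, 6, 7]),
   (27, 42, 1, [0, 5, 7, 6, 1]), (27, 45, 1, [1, 5, 7, 6, 0]), (27, 46, 1, [0, 5, 7, 6, 1]),
   (27, 53, 1, [1, 5, 7, 6, 0]), (27, 61, 1, [1, 5, 7, 6, 0]), (31, 31, 2, [0, 1, 6, 7]),
   (31, 42, 1, [0, 5, 7, 6, 1]), (31, 45, 1, [0, 1, 2, 7, 6]), (31, 46, 1, [0, 5, 7, 6, 1]),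
   (31, 53, 1, [0, 1, 2, 7, 6]), (31, 61, 1, [0, 1, 2, 7, 6]), (36, 36, 5, [3, 4, 5, 6, 2, 7]),
   (42, 42, 2, [1, 5, 6, 7]), (42, 45, 1, [0, 1, 6, 7, 5]), (42, 46, 1, [1, 2, 3, 6, 7]),
   (42, 53, 1, [0, 1, 6, 7, 5]), (42, 61, 1, [0, 1, 6, 7, 5]), (45, 45, 2, [0, 5, 6, 7]),
   (45, 46, 1, [0, 1, 7, 6, 5]), (45, 53, 2, [0, 5, 6, 7]), (45, 61, 1, [3, 4, 5, 6, 7]),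
   (46, 46, 2, [1, 2, 6, 7]), (46, 53, 1, [0, 1, 6, 7, 5]), (46, 61, 1, [0, 1, 6, 7, 5]),
   (53, 53, 2, [0, 5, 6, 7]), (53, 61, 1, [2, 3, 4, 6, 7]), (54, 54, 2, [1, 2, 6, 7]),
   (54, 58, 2, [1, 5, 6, 7]), (54, 62, 1, [2, 3, 4, 6, 7]), (58, 58, 2, [1, 5, 6, 7]),
   (58, 62, 1, [1, 2, 3, 6, 7]), (61, 61, 2, [0, 5, 6, 7]), (62, 62, 2, [1, 2, 6, 7])]

theorem cert1_ok : ∀ s < 64, s ∈ good ∨ Bad 7 s 0 (cert1.getD s (9, [])).1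
    (cert1.getD s (9, [])).2 := by
  decide +kernel

theorem cert2_ok : ∀ c ∈ cert2, Bad 8 c.1 c.2.1 c.2.2.1 c.2.2.2 := by
  decide +kernel

theorem cert2_complete : ∀ s ∈ good, ∀ t ∈ good, col s = col t →
    ∃ c ∈ cert2, (c.1 = s ∧ c.2.1 = t) ∨ (c.1 = t ∧ c.2.1 = s) := by
  decide +kernel

theorem col_mixed : ∀ t ∈ good, ∀ i < 6, t.testBit i = true → col (f3Row i) ≠ col t := by
  decide +kernel

theorem col_inner : ∀ i < 6, ∀ j < 6, (f3Row i).testBit j = true →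
    col (f3Row i) ≠ col (f3Row j) := by
  decide +kernel

theorem mat_inner (i : ℕ) (hi : i < 6) (j : ℕ) (hj : j < 6) (s t : ℕ) :
    mat s t i j = (f3Row i).testBit j := by
  simp [mat, hi, hj]

theorem mat_six (i : ℕ) (hi : i < 6) (s t : ℕ) :
    mat s t i 6 = s.testBit i ∧ mat s t 6 i = s.testBit i := by
  simp [mat, hi]

theorem mat_seven (i : ℕ) (hi : i < 6) (s t : ℕ) :
    mat s t i 7 = t.testBit i ∧ mat s t 7 i = t.testBit i := by
  simp [mat, hi]

theorem mat_outer (s t : ℕ) :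
    mat s t 6 6 = false ∧ mat s t 7 7 = false ∧ mat s t 6 7 = true ∧ mat s t 7 6 = true := by
  simp [mat]

/-- `G` contains none of the six forbidden graphs. -/
structure Free {V : Type*} (G : SimpleGraph V) : Prop where
  hP : IsEmpty (P3P2 ↪g G)
  hW : IsEmpty (W4 ↪g G)
  hK4 : G.CliqueFree 4
  hP2K3 : IsEmpty (P2K3 ↪g G)
  hF1 : IsEmpty (F1 ↪g G)
  hF2 : IsEmpty (F2 ↪g G)

theorem adj_P3P2 (i j : Fin 5) : P3P2.Adj i j ↔ (patRow 0 i).testBit j = true := by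
  unfold P3P2
  fin_cases i <;> fin_cases j <;> simp <;> decide

theorem adj_W4 (i j : Fin 5) : W4.Adj i j ↔ (patRow 1 i).testBit j = true := by
  unfold W4
  fin_cases i <;> fin_cases j <;> simp <;> decide

theorem adj_K4 (i j : Fin 4) : (⊤ : SimpleGraph (Fin 4)).Adj i j ↔
    (patRow 2 i).testBit j = true := by
  revert i j; decide

theorem adj_P2K3 (i j : Fin 5) : P2K3.Adj i j ↔ (patRow 3 i).testBit j = true := by
  unfold P2K3
  fin_cases i <;> fin_cases j <;> simp <;> decide

theorem adj_F1 (i j : Fin 6) : F1.Adj i j ↔ (patRow 4 i).testBit j = true := by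
  unfold F1
  fin_cases i <;> fin_cases j <;> simp <;> decide

theorem adj_F2 (i j : Fin 6) : F2.Adj i j ↔ (patRow 5 i).testBit j = true := by
  unfold F2
  fin_cases i <;> fin_cases j <;> simp <;> decide

theorem adj_F3 (i j : Fin 6) : F3.Adj i j ↔ (f3Row i).testBit j = true := by
  unfold F3
  fin_cases i <;> fin_cases j <;> simp <;> decide

theorem no_emb {V : Type*} {G : SimpleGraph V} {k : ℕ} {F : SimpleGraph (Fin k)}
    (h : IsEmpty (F ↪g G)) (f : ℕ → V)
    (hinj : ∀ i < k, ∀ j < k, f i = f j → i = j)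
    (row : ℕ → ℕ) (hF : ∀ i j : Fin k, F.Adj i j ↔ (row i).testBit j = true)
    (hadj : ∀ i < k, ∀ j < k, (G.Adj (f i) (f j) ↔ (row i).testBit j = true)) : False :=
  h.false
    { toFun := fun i => f i
      inj' := fun i j hij => Fin.ext (hinj i i.2 j j.2 hij)
      map_rel_iff' := fun {i j} => (hadj i i.2 j j.2).trans (hF i j).symm }

theorem not_bad {V : Type*} {G : SimpleGraph V} (hG : Free G) {n s t k : ℕ} {l : List ℕ}
    (w : ℕ → V) (hinj : ∀ i < n, ∀ j < n, w i = w j → i = j)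
    (hadj : ∀ i < n, ∀ j < n, (G.Adj (w i) (w j) ↔ mat s t i j = true)) :
    ¬ Bad n s t k l := by
  rintro ⟨hk, h⟩
  have hi : ∀ i < patSize k, ∀ j < patSize k, w (l.getD i 0) = w (l.getD j 0) → i = j :=
    fun i hi j hj e => ((h i hi).2 j hj).1 (hinj _ (h i hi).1 _ (h j hj).1 e)
  have ha : ∀ i < patSize k, ∀ j < patSize k,
      (G.Adj (w (l.getD i 0)) (w (l.getD j 0)) ↔ (patRow k i).testBit j = true) := by
    intro i hi j hj
    rw [((h i hi).2 j hj).2]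
    exact hadj _ (h i hi).1 _ (h j hj).1
  have key := fun (F : SimpleGraph (Fin (patSize k))) (hF : IsEmpty (F ↪g G)) =>
    no_emb hF (fun i => w (l.getD i 0)) hi (patRow k)
  interval_cases k
  · exact key P3P2 hG.hP adj_P3P2 ha
  · exact key W4 hG.hW adj_W4 ha
  · exact key ⊤ ⟨fun f => (cliqueFree_iff.1 hG.hK4).false f.toCopy⟩ adj_K4 ha
  · exact key P2K3 hG.hP2K3 adj_P2K3 ha
  · exact key F1 hG.hF1 adj_F1 ha
  · exact key F2 hG.hF2 adj_F2 ha

open Classical in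
/-- The neighbourhood of `x` in the copy `e` of `F3`, as a bit mask. -/
noncomputable def typ {V : Type*} {G : SimpleGraph V} (e : F3 ↪g G) (x : V) : ℕ :=
  Nat.ofBits (fun i : Fin 6 => decide (G.Adj (e i) x))

section
variable {V : Type*} {G : SimpleGraph V} (e : F3 ↪g G)

theorem typ_lt (x : V) : typ e x < 64 := Nat.ofBits_lt_two_pow _

theorem typ_testBit (x : V) (i : Fin 6) : (typ e x).testBit i = true ↔ G.Adj (e i) x := by
  unfold typ
  rw [Nat.testBit_ofBits_lt _ _ i.2]
  simp

theorem typ_inner (i : Fin 6) : typ e (e i) = f3Row i := by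
  apply Nat.eq_of_testBit_eq
  intro j
  by_cases hj : j < 6
  · have h1 := typ_testBit e (e i) ⟨j, hj⟩
    rw [e.map_adj_iff, F3.adj_comm, adj_F3] at h1
    exact Bool.eq_iff_iff.2 h1
  · have hb : f3Row i < 2 ^ 6 := by revert i; decide
    have hle : 2 ^ 6 ≤ 2 ^ j := Nat.pow_le_pow_right (by norm_num) (by omega)
    rw [Nat.testBit_lt_two_pow (lt_of_lt_of_le (typ_lt e _) hle),
      Nat.testBit_lt_two_pow (lt_of_lt_of_le hb hle)]

/-- The vertices of the copy of `F3`, followed by `x` and `y`. -/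
def seq (x y : V) (i : ℕ) : V :=
  if h : i < 6 then e ⟨i, h⟩ else if i = 6 then x else y

theorem seq_cases (i : ℕ) (hi : i < 8) : i < 6 ∨ i = 6 ∨ i = 7 := by omega

theorem seq_lt (x y : V) (i : ℕ) (hi : i < 6) : seq e x y i = e ⟨i, hi⟩ := by simp [seq, hi]

theorem seq_six (x y : V) : seq e x y 6 = x := by simp [seq]

theorem seq_seven (x y : V) : seq e x y 7 = y := by simp [seq]

theorem seq_inj {x y : V} (hx : ∀ i, e i ≠ x) (hy : ∀ i, e i ≠ y) (hxy : x ≠ y) :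
    ∀ i < 8, ∀ j < 8, seq e x y i = seq e x y j → i = j := by
  intro i hi j hj h
  rcases seq_cases i hi with h1 | rfl | rfl <;> rcases seq_cases j hj with h2 | rfl | rfl
  · rw [seq_lt _ _ _ _ h1, seq_lt _ _ _ _ h2] at h
    simpa using e.injective h
  · rw [seq_lt _ _ _ _ h1, seq_six] at h; exact absurd h (hx _)
  · rw [seq_lt _ _ _ _ h1, seq_seven] at h; exact absurd h (hy _)
  · rw [seq_lt _ _ _ _ h2, seq_six] at h; exact absurd h.symm (hx _)
  · rfl
  · rw [seq_six, seq_seven] at h; exact absurd h hxy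
  · rw [seq_lt _ _ _ _ h2, seq_seven] at h; exact absurd h.symm (hy _)
  · rw [seq_six, seq_seven] at h; exact absurd h.symm hxy
  · rfl

theorem seq_adj_lt {x y : V} {s t : ℕ} (i j : ℕ)
    (hi : i < 6) (hj : j < 6) :
    G.Adj (seq e x y i) (seq e x y j) ↔ mat s t i j = true := by
  rw [seq_lt _ _ _ _ hi, seq_lt _ _ _ _ hj, e.map_adj_iff, adj_F3, mat_inner i hi j hj]

theorem seq_adj {x y : V} (hxy : G.Adj x y) : ∀ i < 8, ∀ j < 8,
    (G.Adj (seq e x y i) (seq e x y j) ↔ mat (typ e x) (typ e y) i j = true) := by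
  intro i hi j hj
  obtain ⟨o1, o2, o3, o4⟩ := mat_outer (typ e x) (typ e y)
  rcases seq_cases i hi with h1 | rfl | rfl <;> rcases seq_cases j hj with h2 | rfl | rfl
  · exact seq_adj_lt e i j h1 h2
  · rw [seq_lt _ _ _ _ h1, seq_six, (mat_six i h1 _ _).1]
    exact (typ_testBit e x ⟨i, h1⟩).symm
  · rw [seq_lt _ _ _ _ h1, seq_seven, (mat_seven i h1 _ _).1]
    exact (typ_testBit e y ⟨i, h1⟩).symm
  · rw [seq_lt _ _ _ _ h2, seq_six, (mat_six j h2 _ _).2, G.adj_comm]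
    exact (typ_testBit e x ⟨j, h2⟩).symm
  · simp [o1]
  · simp [o3, seq_six, seq_seven, hxy]
  · rw [seq_lt _ _ _ _ h2, seq_seven, (mat_seven j h2 _ _).2, G.adj_comm]
    exact (typ_testBit e y ⟨j, h2⟩).symm
  · simp [o4, seq_six, seq_seven, hxy.symm]
  · simp [o2]

theorem typ_good (hG : Free G) {x : V} (hx : ∀ i, e i ≠ x) : typ e x ∈ good := by
  have hs := typ_lt e x
  refine (cert1_ok _ hs).resolve_right (not_bad hG (seq e x x) ?_ ?_)
  · intro i hi j hj h
    rcases Nat.lt_succ_iff_lt_or_eq.1 hi with h1 | rfl <;>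
      rcases Nat.lt_succ_iff_lt_or_eq.1 hj with h2 | rfl
    · rw [seq_lt _ _ _ _ h1, seq_lt _ _ _ _ h2] at h
      simpa using e.injective h
    · rw [seq_lt _ _ _ _ h1, seq_six] at h; exact absurd h (hx _)
    · rw [seq_lt _ _ _ _ h2, seq_six] at h; exact absurd h.symm (hx _)
    · rfl
  · intro i hi j hj
    rcases Nat.lt_succ_iff_lt_or_eq.1 hi with h1 | rfl <;>
      rcases Nat.lt_succ_iff_lt_or_eq.1 hj with h2 | rfl
    · exact seq_adj_lt e i j h1 h2
    · rw [seq_lt _ _ _ _ h1, seq_six, (mat_six i h1 _ 0).1]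
      exact (typ_testBit e x ⟨i, h1⟩).symm
    · rw [seq_lt _ _ _ _ h2, seq_six, (mat_six j h2 _ 0).2, G.adj_comm]
      exact (typ_testBit e x ⟨j, h2⟩).symm
    · simp [(mat_outer _ 0).1]

theorem col_valid (hG : Free G) {x y : V} (hxy : G.Adj x y) :
    col (typ e x) ≠ col (typ e y) := by
  by_cases hx : ∃ i, e i = x
  · obtain ⟨i, rfl⟩ := hx
    by_cases hy : ∃ j, e j = y
    · obtain ⟨j, rfl⟩ := hy
      rw [typ_inner, typ_inner]
      rw [e.map_adj_iff, adj_F3] at hxy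
      exact col_inner i i.2 j j.2 hxy
    · push Not at hy
      rw [typ_inner]
      exact col_mixed _ (typ_good e hG hy) i i.2 ((typ_testBit e y i).2 hxy)
  · push Not at hx
    by_cases hy : ∃ j, e j = y
    · obtain ⟨j, rfl⟩ := hy
      rw [typ_inner]
      exact (col_mixed _ (typ_good e hG hx) j j.2 ((typ_testBit e x j).2 hxy.symm)).symm
    · push Not at hy
      intro hc
      obtain ⟨c, hmem, hc'⟩ := cert2_complete _ (typ_good e hG hx) _ (typ_good e hG hy) hc
      have hb := cert2_ok c hmem
      rcases hc' with ⟨h1, h2⟩ | ⟨h1, h2⟩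
      · rw [h1, h2] at hb
        exact not_bad hG _ (seq_inj e hx hy hxy.ne) (seq_adj e hxy) hb
      · rw [h1, h2] at hb
        exact not_bad hG _ (seq_inj e hy hx hxy.ne') (seq_adj e hxy.symm) hb

end

end FreeGraphs

theorem stmt16 {V : Type*} [Fintype V] (G : SimpleGraph V)
    (hP : IsEmpty (P3P2 ↪g G)) (hW : IsEmpty (W4 ↪g G)) (hK4 : G.CliqueFree 4)
    (hP2K3 : IsEmpty (P2K3 ↪g G)) (hF1 : IsEmpty (F1 ↪g G)) (hF2 : IsEmpty (F2 ↪g G))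
    (hQ : Nonempty (F3 ↪g G)) :
    G.chromaticNumber ≤ 6 := by
  obtain ⟨e⟩ := hQ
  have hG : FreeGraphs.Free G := ⟨hP, hW, hK4, hP2K3, hF1, hF2⟩
  have hc : G.Colorable 6 :=
    ⟨Coloring.mk (fun x => FreeGraphs.col (FreeGraphs.typ e x))
      (fun {_ _} h => FreeGraphs.col_valid e hG h)⟩
  exact hc.chromaticNumber_le
end

section
/- Let G be a finite simple graph that is (P3∪P2)-free, W4-free, K4-free, (P2∪K3)-free, F1-free, F2-free and F3-free. If G contains an induced subgraph isomorphic to F4, then χ(G) ≤ 6. -/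
open SimpleGraph

/-- `F4`: 6-cycle v1 v2 u2 u1 u3 v3 (= 0 1 2 3 4 5) plus edges v2v3 (1-5), u2u3 (2-4), u2v3 (2-5). -/
def F4 : SimpleGraph (Fin 6) :=
  SimpleGraph.fromEdgeSet {s(0,1), s(1,2), s(2,3), s(3,4), s(4,5), s(5,0), s(1,5), s(2,4), s(2,5)}

/-!
Outline of the argument.

The graph `F4` is the square of a path on six vertices. Relabel the given induced copy as
`b0, ..., b5`, so that two of these vertices are adjacent exactly when their indices differ by one
or two. Each further vertex `v` is classified according to its set of neighbours in this copy.
A short case analysis (the step called `hex` in the main proof, a binary decision tree whose leaves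
either exhibit a forbidden induced subgraph through `v`, or name the surviving trace) shows that
only eight traces can occur, namely

  the empty set, {2}, {3}, {2,3}, {1,4}, {0,3,4}, {1,2,5} and {0,1,4,5}.

Vertices having one common trace are pairwise nonadjacent: an edge between two of them would
complete one of the excluded configurations. The same happens for the pairs of traces
(empty, {2}), ({2,3}, {0,3,4}) and ({1,2,5}, {0,1,4,5}). Hence everything outside the copy splits
into five stable sets, and the six vertices of the copy may be distributed over these without
creating conflicts: `b0` and `b4` go with the first class, `b2` and `b5` join the vertices of
trace {3}, `b3` joins trace {1,4}, while `b1` is placed with the fourth class. Stability of the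
classes is what `ind0`, ..., `ind4` state, so we actually obtain a proper colouring using only five
colours, which is slightly stronger than the bound requested by the theorem.

The lemmas `no_P3P2`, ..., `no_F3` restate each freeness hypothesis pointwise, listing adjacencies,
nonadjacencies and the distinctness of nonadjacent vertices explicitly as arguments.
-/

/-- An induced copy given by pointwise data contradicts `H`-freeness. -/
theorem noEmb {V : Type*} (G : SimpleGraph V) {n : ℕ} (H : SimpleGraph (Fin n))
    (h : IsEmpty (H ↪g G)) (f : Fin n → V) (hd : ∀ i j, i < j → f i ≠ f j)
    (ha : ∀ i j, i < j → (G.Adj (f i) (f j) ↔ H.Adj i j)) : False := by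
  refine h.false ⟨⟨f, ?_⟩, ?_⟩
  · intro i j hij
    rcases lt_trichotomy i j with h1 | h1 | h1
    · exact absurd hij (hd i j h1)
    · exact h1
    · exact absurd hij.symm (hd j i h1)
  · intro i j
    rcases lt_trichotomy i j with h1 | h1 | h1
    · exact ha i j h1
    · subst h1; simp
    · rw [G.adj_comm, H.adj_comm]; exact ha j i h1

theorem no_P3P2 {V : Type*} (G : SimpleGraph V) (h : IsEmpty (P3P2 ↪g G))
    (a b c d e : V) (h01 : G.Adj a b) (d02 : a ≠ c) (h02 : ¬ G.Adj a c) (d03 : a ≠ d) (h03 : ¬ G.Adj a d) (d04 : a ≠ e) (h04 : ¬ G.Adj a e) (h12 : G.Adj b c) (d13 : b ≠ d) (h13 : ¬ G.Adj b d) (d14 : b ≠ e) (h14 : ¬ G.Adj b e) (d23 : c ≠ d) (h23 : ¬ G.Adj c d) (d24 : c ≠ e) (h24 : ¬ G.Adj c e) (h34 : G.Adj d e) : False := by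
  refine noEmb G P3P2 h ![a, b, c, d, e] ?_ ?_
  · intro i j hij
    fin_cases i <;> fin_cases j <;> first | (exact absurd hij (by decide)) | assumption | (exact SimpleGraph.Adj.ne (by assumption))
  · intro i j hij
    fin_cases i <;> fin_cases j <;> simp_all [P3P2]

theorem no_W4 {V : Type*} (G : SimpleGraph V) (h : IsEmpty (W4 ↪g G))
    (a b c d e : V) (h01 : G.Adj a b) (d02 : a ≠ c) (h02 : ¬ G.Adj a c) (h03 : G.Adj a d) (h04 : G.Adj a e) (h12 : G.Adj b c) (d13 : b ≠ d) (h13 : ¬ G.Adj b d) (h14 : G.Adj b e) (h23 : G.Adj c d) (h24 : G.Adj c e) (h34 : G.Adj d e) : False := by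
  refine noEmb G W4 h ![a, b, c, d, e] ?_ ?_
  · intro i j hij
    fin_cases i <;> fin_cases j <;> first | (exact absurd hij (by decide)) | assumption | (exact SimpleGraph.Adj.ne (by assumption))
  · intro i j hij
    fin_cases i <;> fin_cases j <;> simp_all [W4]

theorem no_K4 {V : Type*} (G : SimpleGraph V) (h : G.CliqueFree 4)
    (a b c d : V) (h01 : G.Adj a b) (h02 : G.Adj a c) (h03 : G.Adj a d) (h12 : G.Adj b c) (h13 : G.Adj b d) (h23 : G.Adj c d) : False := by
  classical
  exact h {a, b, c, d} (by simp [SimpleGraph.isNClique_iff, Finset.card_insert_of_notMem, SimpleGraph.isClique_iff, Set.pairwise_insert, *, G.adj_comm, h01.ne, h02.ne, h03.ne, h12.ne, h13.ne, h23.ne])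

theorem no_P2K3 {V : Type*} (G : SimpleGraph V) (h : IsEmpty (P2K3 ↪g G))
    (a b c d e : V) (h01 : G.Adj a b) (d02 : a ≠ c) (h02 : ¬ G.Adj a c) (d03 : a ≠ d) (h03 : ¬ G.Adj a d) (d04 : a ≠ e) (h04 : ¬ G.Adj a e) (d12 : b ≠ c) (h12 : ¬ G.Adj b c) (d13 : b ≠ d) (h13 : ¬ G.Adj b d) (d14 : b ≠ e) (h14 : ¬ G.Adj b e) (h23 : G.Adj c d) (h24 : G.Adj c e) (h34 : G.Adj d e) : False := by
  refine noEmb G P2K3 h ![a, b, c, d, e] ?_ ?_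
  · intro i j hij
    fin_cases i <;> fin_cases j <;> first | (exact absurd hij (by decide)) | assumption | (exact SimpleGraph.Adj.ne (by assumption))
  · intro i j hij
    fin_cases i <;> fin_cases j <;> simp_all [P2K3]

theorem no_F1 {V : Type*} (G : SimpleGraph V) (h : IsEmpty (F1 ↪g G))
    (a b c d e f : V) (h01 : G.Adj a b) (d02 : a ≠ c) (h02 : ¬ G.Adj a c) (d03 : a ≠ d) (h03 : ¬ G.Adj a d) (d04 : a ≠ e) (h04 : ¬ G.Adj a e) (h05 : G.Adj a f) (h12 : G.Adj b c) (d13 : b ≠ d) (h13 : ¬ G.Adj b d) (d14 : b ≠ e) (h14 : ¬ G.Adj b e) (h15 : G.Adj b f) (h23 : G.Adj c d) (h24 : G.Adj c e) (d25 : c ≠ f) (h25 : ¬ G.Adj c f) (h34 : G.Adj d e) (d35 : d ≠ f) (h35 : ¬ G.Adj d f) (h45 : G.Adj e f) : False := by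
  refine noEmb G F1 h ![a, b, c, d, e, f] ?_ ?_
  · intro i j hij
    fin_cases i <;> fin_cases j <;> first | (exact absurd hij (by decide)) | assumption | (exact SimpleGraph.Adj.ne (by assumption))
  · intro i j hij
    fin_cases i <;> fin_cases j <;> simp_all [F1]

theorem no_F2 {V : Type*} (G : SimpleGraph V) (h : IsEmpty (F2 ↪g G))
    (a b c d e f : V) (h01 : G.Adj a b) (d02 : a ≠ c) (h02 : ¬ G.Adj a c) (d03 : a ≠ d) (h03 : ¬ G.Adj a d) (h04 : G.Adj a e) (d05 : a ≠ f) (h05 : ¬ G.Adj a f) (h12 : G.Adj b c) (d13 : b ≠ d) (h13 : ¬ G.Adj b d) (d14 : b ≠ e) (h14 : ¬ G.Adj b e) (d15 : b ≠ f) (h15 : ¬ G.Adj b f) (h23 : G.Adj c d) (d24 : c ≠ e) (h24 : ¬ G.Adj c e) (h25 : G.Adj c f) (h34 : G.Adj d e) (h35 : G.Adj d f) (h45 : G.Adj e f) : False := by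
  refine noEmb G F2 h ![a, b, c, d, e, f] ?_ ?_
  · intro i j hij
    fin_cases i <;> fin_cases j <;> first | (exact absurd hij (by decide)) | assumption | (exact SimpleGraph.Adj.ne (by assumption))
  · intro i j hij
    fin_cases i <;> fin_cases j <;> simp_all [F2]

theorem no_F3 {V : Type*} (G : SimpleGraph V) (h : IsEmpty (F3 ↪g G))
    (a b c d e f : V) (h01 : G.Adj a b) (d02 : a ≠ c) (h02 : ¬ G.Adj a c) (d03 : a ≠ d) (h03 : ¬ G.Adj a d) (d04 : a ≠ e) (h04 : ¬ G.Adj a e) (h05 : G.Adj a f) (h12 : G.Adj b c) (d13 : b ≠ d) (h13 : ¬ G.Adj b d) (d14 : b ≠ e) (h14 : ¬ G.Adj b e) (h15 : G.Adj b f) (h23 : G.Adj c d) (d24 : c ≠ e) (h24 : ¬ G.Adj c e) (d25 : c ≠ f) (h25 : ¬ G.Adj c f) (h34 : G.Adj d e) (d35 : d ≠ f) (h35 : ¬ G.Adj d f) (h45 : G.Adj e f) : False := by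
  refine noEmb G F3 h ![a, b, c, d, e, f] ?_ ?_
  · intro i j hij
    fin_cases i <;> fin_cases j <;> first | (exact absurd hij (by decide)) | assumption | (exact SimpleGraph.Adj.ne (by assumption))
  · intro i j hij
    fin_cases i <;> fin_cases j <;> simp_all [F3]

theorem stmt17 {V : Type*} [Fintype V] (G : SimpleGraph V)
    (hP : IsEmpty (P3P2 ↪g G)) (hW : IsEmpty (W4 ↪g G)) (hK4 : G.CliqueFree 4)
    (hP2K3 : IsEmpty (P2K3 ↪g G)) (hF1 : IsEmpty (F1 ↪g G)) (hF2 : IsEmpty (F2 ↪g G))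
    (hF3 : IsEmpty (F3 ↪g G)) (hQ : Nonempty (F4 ↪g G)) :
    G.chromaticNumber ≤ 6 := by
  obtain ⟨f⟩ := hQ
  have nP3P2 := no_P3P2 G hP
  have nW4 := no_W4 G hW
  have nK4 := no_K4 G hK4
  have nP2K3 := no_P2K3 G hP2K3
  have nF1 := no_F1 G hF1
  have nF2 := no_F2 G hF2
  have nF3 := no_F3 G hF3
  have e01 : G.Adj (f 0) (f 1) := f.map_rel_iff.2 (by simp [F4])
  have e02 : G.Adj (f 0) (f 5) := f.map_rel_iff.2 (by simp [F4])
  have n03 : ¬ G.Adj (f 0) (f 2) := fun h => by simpa [F4] using f.map_rel_iff.1 h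
  have d03 : f 0 ≠ f 2 := f.injective.ne (by decide)
  have n04 : ¬ G.Adj (f 0) (f 4) := fun h => by simpa [F4] using f.map_rel_iff.1 h
  have d04 : f 0 ≠ f 4 := f.injective.ne (by decide)
  have n05 : ¬ G.Adj (f 0) (f 3) := fun h => by simpa [F4] using f.map_rel_iff.1 h
  have d05 : f 0 ≠ f 3 := f.injective.ne (by decide)
  have e12 : G.Adj (f 1) (f 5) := f.map_rel_iff.2 (by simp [F4])
  have e13 : G.Adj (f 1) (f 2) := f.map_rel_iff.2 (by simp [F4])
  have n14 : ¬ G.Adj (f 1) (f 4) := fun h => by simpa [F4] using f.map_rel_iff.1 h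
  have d14 : f 1 ≠ f 4 := f.injective.ne (by decide)
  have n15 : ¬ G.Adj (f 1) (f 3) := fun h => by simpa [F4] using f.map_rel_iff.1 h
  have d15 : f 1 ≠ f 3 := f.injective.ne (by decide)
  have e23 : G.Adj (f 5) (f 2) := f.map_rel_iff.2 (by simp [F4])
  have e24 : G.Adj (f 5) (f 4) := f.map_rel_iff.2 (by simp [F4])
  have n25 : ¬ G.Adj (f 5) (f 3) := fun h => by simpa [F4] using f.map_rel_iff.1 h
  have d25 : f 5 ≠ f 3 := f.injective.ne (by decide)
  have e34 : G.Adj (f 2) (f 4) := f.map_rel_iff.2 (by simp [F4])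
  have e35 : G.Adj (f 2) (f 3) := f.map_rel_iff.2 (by simp [F4])
  have e45 : G.Adj (f 4) (f 3) := f.map_rel_iff.2 (by simp [F4])
  generalize f 0 = b0 at *
  generalize f 1 = b1 at *
  generalize f 5 = b2 at *
  generalize f 2 = b3 at *
  generalize f 4 = b4 at *
  generalize f 3 = b5 at *
  clear hP hW hK4 hP2K3 hF1 hF2 hF3 f
  let Q : Fin 5 → V → Prop := fun k v => match k with
    | 0 => v = b0 ∨ v = b4 ∨ (¬ G.Adj v b0 ∧ ¬ G.Adj v b1 ∧ ¬ G.Adj v b2 ∧ ¬ G.Adj v b3 ∧ ¬ G.Adj v b4 ∧ ¬ G.Adj v b5) ∨ (¬ G.Adj v b0 ∧ ¬ G.Adj v b1 ∧ G.Adj v b2 ∧ ¬ G.Adj v b3 ∧ ¬ G.Adj v b4 ∧ ¬ G.Adj v b5)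
    | 1 => v = b2 ∨ v = b5 ∨ (¬ G.Adj v b0 ∧ ¬ G.Adj v b1 ∧ ¬ G.Adj v b2 ∧ G.Adj v b3 ∧ ¬ G.Adj v b4 ∧ ¬ G.Adj v b5)
    | 2 => v = b3 ∨ (¬ G.Adj v b0 ∧ G.Adj v b1 ∧ ¬ G.Adj v b2 ∧ ¬ G.Adj v b3 ∧ G.Adj v b4 ∧ ¬ G.Adj v b5)
    | 3 => v = b1 ∨ (¬ G.Adj v b0 ∧ ¬ G.Adj v b1 ∧ G.Adj v b2 ∧ G.Adj v b3 ∧ ¬ G.Adj v b4 ∧ ¬ G.Adj v b5) ∨ (G.Adj v b0 ∧ ¬ G.Adj v b1 ∧ ¬ G.Adj v b2 ∧ G.Adj v b3 ∧ G.Adj v b4 ∧ ¬ G.Adj v b5)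
    | 4 => (¬ G.Adj v b0 ∧ G.Adj v b1 ∧ G.Adj v b2 ∧ ¬ G.Adj v b3 ∧ ¬ G.Adj v b4 ∧ G.Adj v b5) ∨ (G.Adj v b0 ∧ G.Adj v b1 ∧ ¬ G.Adj v b2 ∧ ¬ G.Adj v b3 ∧ G.Adj v b4 ∧ G.Adj v b5)
  have hex : ∀ v, ∃ k, Q k v := by
    intro v
    by_cases dv0 : v = b0
    · exact ⟨0, Or.inl (dv0)⟩
    by_cases dv1 : v = b1
    · exact ⟨3, Or.inl (dv1)⟩
    by_cases dv2 : v = b2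
    · exact ⟨1, Or.inl (dv2)⟩
    by_cases dv3 : v = b3
    · exact ⟨2, Or.inl (dv3)⟩
    by_cases dv4 : v = b4
    · exact ⟨0, Or.inr (Or.inl (dv4))⟩
    by_cases dv5 : v = b5
    · exact ⟨1, Or.inr (Or.inl (dv5))⟩
    by_cases ev1 : G.Adj v b1
    ·
      by_cases ev2 : G.Adj v b2
      ·
        by_cases ev0 : G.Adj v b0
        ·
          exact (nK4 v b0 b1 b2 ev0 ev1 ev2 e01 e02 e12).elim
        · have nv0 := ev0
          by_cases ev3 : G.Adj v b3
          ·
            exact (nK4 v b1 b2 b3 ev1 ev2 ev3 e12 e13 e23).elim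
          · have nv3 := ev3
            by_cases ev4 : G.Adj v b4
            ·
              exact (nW4 v b1 b3 b4 b2 ev1 dv3 nv3 ev4 ev2 e13 d14 n14 e12 e34 e23.symm e24.symm).elim
            · have nv4 := ev4
              by_cases ev5 : G.Adj v b5
              ·
                exact ⟨4, Or.inl (⟨nv0, ev1, ev2, nv3, nv4, ev5⟩)⟩
              · have nv5 := ev5
                exact (nP3P2 v b1 b0 b4 b5 ev1 dv0 nv0 dv4 nv4 dv5 nv5 e01.symm d14 n14 d15 n15 d04 n04 d05 n05 e45).elim
      · have nv2 := ev2
        by_cases ev4 : G.Adj v b4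
        ·
          by_cases ev3 : G.Adj v b3
          ·
            exact (nW4 v b1 b2 b4 b3 ev1 dv2 nv2 ev4 ev3 e12 d14 n14 e13 e24 e23 e34.symm).elim
          · have nv3 := ev3
            by_cases ev0 : G.Adj v b0
            ·
              by_cases ev5 : G.Adj v b5
              ·
                exact ⟨4, Or.inr (⟨ev0, ev1, nv2, nv3, ev4, ev5⟩)⟩
              · have nv5 := ev5
                exact (nF1 b0 v b4 b5 b3 b1 ev0.symm d04 n04 d05 n05 d03 n03 e01 ev4 dv5 nv5 dv3 nv3 ev1 e45 e34.symm (Ne.symm d14) (fun h => n14 h.symm) e35.symm (Ne.symm d15) (fun h => n15 h.symm) e13.symm).elim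
            · have nv0 := ev0
              by_cases ev5 : G.Adj v b5
              ·
                exact (nF1 b0 b1 v b5 b4 b2 e01 (Ne.symm dv0) (fun h => nv0 h.symm) d05 n05 d04 n04 e02 ev1.symm d15 n15 d14 n14 e12 ev5 ev4 dv2 nv2 e45.symm (Ne.symm d25) (fun h => n25 h.symm) e24.symm).elim
              · have nv5 := ev5
                exact ⟨2, Or.inr (⟨nv0, ev1, nv2, nv3, ev4, nv5⟩)⟩
        · have nv4 := ev4
          by_cases ev0 : G.Adj v b0
          ·
            by_cases ev5 : G.Adj v b5
            ·
              exact (nF2 b4 b5 v b0 b2 b1 e45 (Ne.symm dv4) (fun h => nv4 h.symm) (Ne.symm d04) (fun h => n04 h.symm) e24.symm (Ne.symm d14) (fun h => n14 h.symm) ev5.symm (Ne.symm d05) (fun h => n05 h.symm) (Ne.symm d25) (fun h => n25 h.symm) (Ne.symm d15) (fun h => n15 h.symm) ev0 dv2 nv2 ev1 e02 e01 e12.symm).elim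
            · have nv5 := ev5
              exact (nP2K3 b4 b5 v b0 b1 e45 (Ne.symm dv4) (fun h => nv4 h.symm) (Ne.symm d04) (fun h => n04 h.symm) (Ne.symm d14) (fun h => n14 h.symm) (Ne.symm dv5) (fun h => nv5 h.symm) (Ne.symm d05) (fun h => n05 h.symm) (Ne.symm d15) (fun h => n15 h.symm) ev0 ev1 e01).elim
          · have nv0 := ev0
            by_cases ev5 : G.Adj v b5
            ·
              exact (nF3 b0 b1 v b5 b4 b2 e01 (Ne.symm dv0) (fun h => nv0 h.symm) d05 n05 d04 n04 e02 ev1.symm d15 n15 d14 n14 e12 ev5 dv4 nv4 dv2 nv2 e45.symm (Ne.symm d25) (fun h => n25 h.symm) e24.symm).elim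
            · have nv5 := ev5
              exact (nP3P2 v b1 b0 b4 b5 ev1 dv0 nv0 dv4 nv4 dv5 nv5 e01.symm d14 n14 d15 n15 d04 n04 d05 n05 e45).elim
    · have nv1 := ev1
      by_cases ev0 : G.Adj v b0
      ·
        by_cases ev3 : G.Adj v b3
        ·
          by_cases ev2 : G.Adj v b2
          ·
            exact (nW4 v b0 b1 b3 b2 ev0 dv1 nv1 ev3 ev2 e01 d03 n03 e02 e13 e12 e23.symm).elim
          · have nv2 := ev2
            by_cases ev4 : G.Adj v b4
            ·
              by_cases ev5 : G.Adj v b5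
              ·
                exact (nK4 v b3 b4 b5 ev3 ev4 ev5 e34 e35 e45).elim
              · have nv5 := ev5
                exact ⟨3, Or.inr (Or.inr (⟨ev0, nv1, nv2, ev3, ev4, nv5⟩))⟩
            · have nv4 := ev4
              by_cases ev5 : G.Adj v b5
              ·
                exact (nF3 b1 b0 v b5 b4 b2 e01.symm (Ne.symm dv1) (fun h => nv1 h.symm) d15 n15 d14 n14 e12 ev0.symm d05 n05 d04 n04 e02 ev5 dv4 nv4 dv2 nv2 e45.symm (Ne.symm d25) (fun h => n25 h.symm) e24.symm).elim
              · have nv5 := ev5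
                exact (nP3P2 v b0 b1 b4 b5 ev0 dv1 nv1 dv4 nv4 dv5 nv5 e01 d04 n04 d05 n05 d14 n14 d15 n15 e45).elim
        · have nv3 := ev3
          by_cases ev4 : G.Adj v b4
          ·
            by_cases ev5 : G.Adj v b5
            ·
              exact (nF2 b0 b1 b3 b4 v b5 e01 d03 n03 d04 n04 ev0.symm d05 n05 e13 d14 n14 (Ne.symm dv1) (fun h => nv1 h.symm) d15 n15 e34 (Ne.symm dv3) (fun h => nv3 h.symm) e35 ev4.symm e45 ev5).elim
            · have nv5 := ev5
              exact (nF3 b5 b3 b1 b0 v b4 e35.symm (Ne.symm d15) (fun h => n15 h.symm) (Ne.symm d05) (fun h => n05 h.symm) (Ne.symm dv5) (fun h => nv5 h.symm) e45.symm e13.symm (Ne.symm d03) (fun h => n03 h.symm) (Ne.symm dv3) (fun h => nv3 h.symm) e34 e01.symm (Ne.symm dv1) (fun h => nv1 h.symm) d14 n14 ev0.symm d04 n04 ev4).elim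
          · have nv4 := ev4
            by_cases ev5 : G.Adj v b5
            ·
              exact (nF3 b4 b3 b1 b0 v b5 e34.symm (Ne.symm d14) (fun h => n14 h.symm) (Ne.symm d04) (fun h => n04 h.symm) (Ne.symm dv4) (fun h => nv4 h.symm) e45 e13.symm (Ne.symm d03) (fun h => n03 h.symm) (Ne.symm dv3) (fun h => nv3 h.symm) e35 e01.symm (Ne.symm dv1) (fun h => nv1 h.symm) d15 n15 ev0.symm d05 n05 ev5).elim
            · have nv5 := ev5
              exact (nP3P2 v b0 b1 b4 b5 ev0 dv1 nv1 dv4 nv4 dv5 nv5 e01 d04 n04 d05 n05 d14 n14 d15 n15 e45).elim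
      · have nv0 := ev0
        by_cases ev4 : G.Adj v b4
        ·
          by_cases ev5 : G.Adj v b5
          ·
            exact (nP2K3 b0 b1 v b4 b5 e01 (Ne.symm dv0) (fun h => nv0 h.symm) d04 n04 d05 n05 (Ne.symm dv1) (fun h => nv1 h.symm) d14 n14 d15 n15 ev4 ev5 e45).elim
          · have nv5 := ev5
            exact (nP3P2 v b4 b5 b0 b1 ev4 dv5 nv5 dv0 nv0 dv1 nv1 e45 (Ne.symm d04) (fun h => n04 h.symm) (Ne.symm d14) (fun h => n14 h.symm) (Ne.symm d05) (fun h => n05 h.symm) (Ne.symm d15) (fun h => n15 h.symm) e01).elim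
        · have nv4 := ev4
          by_cases ev5 : G.Adj v b5
          ·
            exact (nP3P2 v b5 b4 b0 b1 ev5 dv4 nv4 dv0 nv0 dv1 nv1 e45.symm (Ne.symm d05) (fun h => n05 h.symm) (Ne.symm d15) (fun h => n15 h.symm) (Ne.symm d04) (fun h => n04 h.symm) (Ne.symm d14) (fun h => n14 h.symm) e01).elim
          · have nv5 := ev5
            by_cases ev2 : G.Adj v b2
            ·
              by_cases ev3 : G.Adj v b3
              ·
                exact ⟨3, Or.inr (Or.inl (⟨nv0, nv1, ev2, ev3, nv4, nv5⟩))⟩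
              · have nv3 := ev3
                exact ⟨0, Or.inr (Or.inr (Or.inr (⟨nv0, nv1, ev2, nv3, nv4, nv5⟩)))⟩
            · have nv2 := ev2
              by_cases ev3 : G.Adj v b3
              ·
                exact ⟨1, Or.inr (Or.inr (⟨nv0, nv1, nv2, ev3, nv4, nv5⟩))⟩
              · have nv3 := ev3
                exact ⟨0, Or.inr (Or.inr (Or.inl (⟨nv0, nv1, nv2, nv3, nv4, nv5⟩)))⟩
  have ind0 : ∀ u v, Q 0 u → Q 0 v → ¬ G.Adj u v := by
    intro u v hu hv euv
    rcases hu with du0 | du4 | ⟨nu0, nu1, nu2, nu3, nu4, nu5⟩ | ⟨nu0, nu1, eu2, nu3, nu4, nu5⟩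
    ·
      rw [du0] at euv
      rcases hv with dv0 | dv4 | ⟨nv0, nv1, nv2, nv3, nv4, nv5⟩ | ⟨nv0, nv1, ev2, nv3, nv4, nv5⟩
      · rw [dv0] at euv
        exact G.irrefl euv
      · rw [dv4] at euv
        exact n04 euv
      ·
        exact nv0 euv.symm
      ·
        exact nv0 euv.symm
    ·
      rw [du4] at euv
      rcases hv with dv0 | dv4 | ⟨nv0, nv1, nv2, nv3, nv4, nv5⟩ | ⟨nv0, nv1, ev2, nv3, nv4, nv5⟩
      · rw [dv0] at euv
        exact n04 euv.symm
      · rw [dv4] at euv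
        exact G.irrefl euv
      ·
        exact nv4 euv.symm
      ·
        exact nv4 euv.symm
    ·
      rcases hv with dv0 | dv4 | ⟨nv0, nv1, nv2, nv3, nv4, nv5⟩ | ⟨nv0, nv1, ev2, nv3, nv4, nv5⟩
      · rw [dv0] at euv
        exact nu0 euv
      · rw [dv4] at euv
        exact nu4 euv
      ·
        have du0 : u ≠ b0 := fun h => nu1 (h ▸ e01)
        have dv0 : v ≠ b0 := fun h => nv1 (h ▸ e01)
        have du1 : u ≠ b1 := fun h => nu0 (h ▸ e01.symm)
        have dv1 : v ≠ b1 := fun h => nv0 (h ▸ e01.symm)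
        have du3 : u ≠ b3 := fun h => nu1 (h ▸ e13.symm)
        have dv3 : v ≠ b3 := fun h => nv1 (h ▸ e13.symm)
        exact nP3P2 b0 b1 b3 u v e01 d03 n03 (Ne.symm du0) (fun h => nu0 h.symm) (Ne.symm dv0) (fun h => nv0 h.symm) e13 (Ne.symm du1) (fun h => nu1 h.symm) (Ne.symm dv1) (fun h => nv1 h.symm) (Ne.symm du3) (fun h => nu3 h.symm) (Ne.symm dv3) (fun h => nv3 h.symm) euv
      ·
        have du0 : u ≠ b0 := fun h => nu1 (h ▸ e01)
        have dv0 : v ≠ b0 := fun h => nv1 (h ▸ e01)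
        have du1 : u ≠ b1 := fun h => nu0 (h ▸ e01.symm)
        have dv1 : v ≠ b1 := fun h => nv0 (h ▸ e01.symm)
        have du3 : u ≠ b3 := fun h => nu1 (h ▸ e13.symm)
        have dv3 : v ≠ b3 := fun h => nv1 (h ▸ e13.symm)
        exact nP3P2 b0 b1 b3 u v e01 d03 n03 (Ne.symm du0) (fun h => nu0 h.symm) (Ne.symm dv0) (fun h => nv0 h.symm) e13 (Ne.symm du1) (fun h => nu1 h.symm) (Ne.symm dv1) (fun h => nv1 h.symm) (Ne.symm du3) (fun h => nu3 h.symm) (Ne.symm dv3) (fun h => nv3 h.symm) euv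
    ·
      rcases hv with dv0 | dv4 | ⟨nv0, nv1, nv2, nv3, nv4, nv5⟩ | ⟨nv0, nv1, ev2, nv3, nv4, nv5⟩
      · rw [dv0] at euv
        exact nu0 euv
      · rw [dv4] at euv
        exact nu4 euv
      ·
        have du0 : u ≠ b0 := fun h => nu1 (h ▸ e01)
        have dv0 : v ≠ b0 := fun h => nv1 (h ▸ e01)
        have du1 : u ≠ b1 := fun h => nu0 (h ▸ e01.symm)
        have dv1 : v ≠ b1 := fun h => nv0 (h ▸ e01.symm)
        have du3 : u ≠ b3 := fun h => nu1 (h ▸ e13.symm)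
        have dv3 : v ≠ b3 := fun h => nv1 (h ▸ e13.symm)
        exact nP3P2 b0 b1 b3 u v e01 d03 n03 (Ne.symm du0) (fun h => nu0 h.symm) (Ne.symm dv0) (fun h => nv0 h.symm) e13 (Ne.symm du1) (fun h => nu1 h.symm) (Ne.symm dv1) (fun h => nv1 h.symm) (Ne.symm du3) (fun h => nu3 h.symm) (Ne.symm dv3) (fun h => nv3 h.symm) euv
      ·
        have du0 : u ≠ b0 := fun h => nu1 (h ▸ e01)
        have dv0 : v ≠ b0 := fun h => nv1 (h ▸ e01)
        have du1 : u ≠ b1 := fun h => nu0 (h ▸ e01.symm)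
        have dv1 : v ≠ b1 := fun h => nv0 (h ▸ e01.symm)
        have du3 : u ≠ b3 := fun h => nu1 (h ▸ e13.symm)
        have dv3 : v ≠ b3 := fun h => nv1 (h ▸ e13.symm)
        exact nP3P2 b0 b1 b3 u v e01 d03 n03 (Ne.symm du0) (fun h => nu0 h.symm) (Ne.symm dv0) (fun h => nv0 h.symm) e13 (Ne.symm du1) (fun h => nu1 h.symm) (Ne.symm dv1) (fun h => nv1 h.symm) (Ne.symm du3) (fun h => nu3 h.symm) (Ne.symm dv3) (fun h => nv3 h.symm) euv
  have ind1 : ∀ u v, Q 1 u → Q 1 v → ¬ G.Adj u v := by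
    intro u v hu hv euv
    rcases hu with du2 | du5 | ⟨nu0, nu1, nu2, eu3, nu4, nu5⟩
    ·
      rw [du2] at euv
      rcases hv with dv2 | dv5 | ⟨nv0, nv1, nv2, ev3, nv4, nv5⟩
      · rw [dv2] at euv
        exact G.irrefl euv
      · rw [dv5] at euv
        exact n25 euv
      ·
        exact nv2 euv.symm
    ·
      rw [du5] at euv
      rcases hv with dv2 | dv5 | ⟨nv0, nv1, nv2, ev3, nv4, nv5⟩
      · rw [dv2] at euv
        exact n25 euv.symm
      · rw [dv5] at euv
        exact G.irrefl euv
      ·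
        exact nv5 euv.symm
    ·
      rcases hv with dv2 | dv5 | ⟨nv0, nv1, nv2, ev3, nv4, nv5⟩
      · rw [dv2] at euv
        exact nu2 euv
      · rw [dv5] at euv
        exact nu5 euv
      ·
        have du0 : u ≠ b0 := fun h => nu1 (h ▸ e01)
        have dv0 : v ≠ b0 := fun h => nv1 (h ▸ e01)
        have du2 : u ≠ b2 := fun h => nu0 (h ▸ e02.symm)
        have dv2 : v ≠ b2 := fun h => nv0 (h ▸ e02.symm)
        have du4 : u ≠ b4 := fun h => nu2 (h ▸ e24.symm)
        have dv4 : v ≠ b4 := fun h => nv2 (h ▸ e24.symm)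
        exact nP3P2 b0 b2 b4 u v e02 d04 n04 (Ne.symm du0) (fun h => nu0 h.symm) (Ne.symm dv0) (fun h => nv0 h.symm) e24 (Ne.symm du2) (fun h => nu2 h.symm) (Ne.symm dv2) (fun h => nv2 h.symm) (Ne.symm du4) (fun h => nu4 h.symm) (Ne.symm dv4) (fun h => nv4 h.symm) euv
  have ind2 : ∀ u v, Q 2 u → Q 2 v → ¬ G.Adj u v := by
    intro u v hu hv euv
    rcases hu with du3 | ⟨nu0, eu1, nu2, nu3, eu4, nu5⟩
    ·
      rw [du3] at euv
      rcases hv with dv3 | ⟨nv0, ev1, nv2, nv3, ev4, nv5⟩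
      · rw [dv3] at euv
        exact G.irrefl euv
      ·
        exact nv3 euv.symm
    ·
      rcases hv with dv3 | ⟨nv0, ev1, nv2, nv3, ev4, nv5⟩
      · rw [dv3] at euv
        exact nu3 euv
      ·
        have du0 : u ≠ b0 := fun h => nu2 (h ▸ e02)
        have dv0 : v ≠ b0 := fun h => nv2 (h ▸ e02)
        have du2 : u ≠ b2 := fun h => nu0 (h ▸ e02.symm)
        have dv2 : v ≠ b2 := fun h => nv0 (h ▸ e02.symm)
        have du3 : u ≠ b3 := fun h => nu2 (h ▸ e23.symm)
        have dv3 : v ≠ b3 := fun h => nv2 (h ▸ e23.symm)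
        exact nP3P2 b0 b2 b3 u v e02 d03 n03 (Ne.symm du0) (fun h => nu0 h.symm) (Ne.symm dv0) (fun h => nv0 h.symm) e23 (Ne.symm du2) (fun h => nu2 h.symm) (Ne.symm dv2) (fun h => nv2 h.symm) (Ne.symm du3) (fun h => nu3 h.symm) (Ne.symm dv3) (fun h => nv3 h.symm) euv
  have ind3 : ∀ u v, Q 3 u → Q 3 v → ¬ G.Adj u v := by
    intro u v hu hv euv
    rcases hu with du1 | ⟨nu0, nu1, eu2, eu3, nu4, nu5⟩ | ⟨eu0, nu1, nu2, eu3, eu4, nu5⟩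
    ·
      rw [du1] at euv
      rcases hv with dv1 | ⟨nv0, nv1, ev2, ev3, nv4, nv5⟩ | ⟨ev0, nv1, nv2, ev3, ev4, nv5⟩
      · rw [dv1] at euv
        exact G.irrefl euv
      ·
        exact nv1 euv.symm
      ·
        exact nv1 euv.symm
    ·
      rcases hv with dv1 | ⟨nv0, nv1, ev2, ev3, nv4, nv5⟩ | ⟨ev0, nv1, nv2, ev3, ev4, nv5⟩
      · rw [dv1] at euv
        exact nu1 euv
      ·
        exact nK4 u v b2 b3 euv eu2 eu3 ev2 ev3 e23
      ·
        have du4 : u ≠ b4 := fun h => nu5 (h ▸ e45)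
        have dv2 : v ≠ b2 := fun h => nv1 (h ▸ e12.symm)
        exact nW4 u v b4 b2 b3 euv du4 nu4 eu2 eu3 ev4 dv2 nv2 ev3 e24.symm e34.symm e23
    ·
      rcases hv with dv1 | ⟨nv0, nv1, ev2, ev3, nv4, nv5⟩ | ⟨ev0, nv1, nv2, ev3, ev4, nv5⟩
      · rw [dv1] at euv
        exact nu1 euv
      ·
        have du2 : u ≠ b2 := fun h => nu1 (h ▸ e12.symm)
        have dv4 : v ≠ b4 := fun h => nv5 (h ▸ e45)
        exact nW4 u v b2 b4 b3 euv du2 nu2 eu4 eu3 ev2 dv4 nv4 ev3 e24 e23 e34.symm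
      ·
        exact nK4 u v b3 b4 euv eu3 eu4 ev3 ev4 e34
  have ind4 : ∀ u v, Q 4 u → Q 4 v → ¬ G.Adj u v := by
    intro u v hu hv euv
    rcases hu with ⟨nu0, eu1, eu2, nu3, nu4, eu5⟩ | ⟨eu0, eu1, nu2, nu3, eu4, eu5⟩
    ·
      rcases hv with ⟨nv0, ev1, ev2, nv3, nv4, ev5⟩ | ⟨ev0, ev1, nv2, nv3, ev4, ev5⟩
      ·
        exact nK4 u v b1 b2 euv eu1 eu2 ev1 ev2 e12
      ·
        have du0 : u ≠ b0 := fun h => absurd (h ▸ eu5 : G.Adj b0 b5) n05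
        have dv2 : v ≠ b2 := fun h => nv3 (h ▸ e23)
        exact nW4 u v b0 b2 b1 euv du0 nu0 eu2 eu1 ev0 dv2 nv2 ev1 e02 e01 e12.symm
    ·
      rcases hv with ⟨nv0, ev1, ev2, nv3, nv4, ev5⟩ | ⟨ev0, ev1, nv2, nv3, ev4, ev5⟩
      ·
        have du2 : u ≠ b2 := fun h => nu3 (h ▸ e23)
        have dv0 : v ≠ b0 := fun h => absurd (h ▸ ev5 : G.Adj b0 b5) n05
        exact nW4 u v b2 b0 b1 euv du2 nu2 eu0 eu1 ev2 dv0 nv0 ev1 e02.symm e12.symm e01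
      ·
        exact nK4 u v b0 b1 euv eu0 eu1 ev0 ev1 e01
  choose c hc using hex
  have hcol : G.Colorable 5 := by
    refine ⟨SimpleGraph.Coloring.mk c ?_⟩
    intro u v huv hcc
    have h1 := hc u
    have h2 := hc v
    rw [← hcc] at h2
    generalize c u = k at h1 h2
    fin_cases k
    · exact ind0 u v h1 h2 huv
    · exact ind1 u v h1 h2 huv
    · exact ind2 u v h1 h2 huv
    · exact ind3 u v h1 h2 huv
    · exact ind4 u v h1 h2 huv
  exact (hcol.mono (by decide : 5 ≤ 6)).chromaticNumber_le
end

section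
/- Let G be a finite simple graph that is (P3∪P2)-free, W4-free, K4-free, (P2∪K3)-free, F1-free, F2-free, F3-free and F4-free. If G contains an induced subgraph isomorphic to the hammer, then χ(G) ≤ 6. -/
open SimpleGraph

/-- The hammer: triangle (0,1,2) with a path 2-3-4 attached at vertex 2. -/
def hammer : SimpleGraph (Fin 5) :=
  SimpleGraph.fromEdgeSet {s(0,1), s(1,2), s(0,2), s(2,3), s(3,4)}


namespace Hammer

universe u

/-- An embedding of a graph on `Fin n` from its values on ordered pairs. -/
theorem emb {V : Type u} {G : SimpleGraph V} {n : ℕ} {H : SimpleGraph (Fin n)}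
    (hE : IsEmpty (H ↪g G)) (f : Fin n → V)
    (h : ∀ i j, i < j → f i ≠ f j ∧ (G.Adj (f i) (f j) ↔ H.Adj i j)) : False := by
  have inj : Function.Injective f := by
    intro i j hij
    rcases lt_trichotomy i j with hl | hl | hl
    · exact absurd hij (h i j hl).1
    · exact hl
    · exact absurd hij.symm (h j i hl).1
  refine hE.false ⟨⟨f, inj⟩, ?_⟩
  intro i j
  change G.Adj (f i) (f j) ↔ H.Adj i j
  rcases lt_trichotomy i j with hl | hl | hl
  · exact (h i j hl).2
  · subst hl; simp
  · rw [G.adj_comm, H.adj_comm]; exact (h j i hl).2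

theorem ns {V : Type u} {G : SimpleGraph V} {x y : V} (h : ¬ G.Adj x y) : ¬ G.Adj y x :=
  fun k => h k.symm

/-- The forbidden induced subgraphs, in explicit form. -/
structure Free {V : Type u} (G : SimpleGraph V) : Prop where
  P3P2 : ∀ {a b c d e : V}, a ≠ c → G.Adj a b → ¬ G.Adj a c → ¬ G.Adj a d → ¬ G.Adj a e → G.Adj b c → ¬ G.Adj b d → ¬ G.Adj b e → ¬ G.Adj c d → ¬ G.Adj c e → G.Adj d e → False
  W4 : ∀ {a b c d e : V}, a ≠ c → b ≠ d → G.Adj a b → ¬ G.Adj a c → G.Adj a d → G.Adj a e → G.Adj b c → ¬ G.Adj b d → G.Adj b e → G.Adj c d → G.Adj c e → G.Adj d e → False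
  K4 : ∀ {a b c d : V}, G.Adj a b → G.Adj a c → G.Adj a d → G.Adj b c → G.Adj b d → G.Adj c d → False
  P2K3 : ∀ {a b c d e : V}, G.Adj a b → ¬ G.Adj a c → ¬ G.Adj a d → ¬ G.Adj a e → ¬ G.Adj b c → ¬ G.Adj b d → ¬ G.Adj b e → G.Adj c d → G.Adj c e → G.Adj d e → False
  F1 : ∀ {a b c d e f : V}, G.Adj a b → ¬ G.Adj a c → ¬ G.Adj a d → ¬ G.Adj a e → G.Adj a f → G.Adj b c → ¬ G.Adj b d → ¬ G.Adj b e → G.Adj b f → G.Adj c d → G.Adj c e → ¬ G.Adj c f → G.Adj d e → ¬ G.Adj d f → G.Adj e f → False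
  F2 : ∀ {a b c d e f : V}, G.Adj a b → ¬ G.Adj a c → ¬ G.Adj a d → G.Adj a e → ¬ G.Adj a f → G.Adj b c → ¬ G.Adj b d → ¬ G.Adj b e → ¬ G.Adj b f → G.Adj c d → ¬ G.Adj c e → G.Adj c f → G.Adj d e → G.Adj d f → G.Adj e f → False
  F3 : ∀ {a b c d e f : V}, G.Adj a b → ¬ G.Adj a c → ¬ G.Adj a d → ¬ G.Adj a e → G.Adj a f → G.Adj b c → ¬ G.Adj b d → ¬ G.Adj b e → G.Adj b f → G.Adj c d → ¬ G.Adj c e → ¬ G.Adj c f → G.Adj d e → ¬ G.Adj d f → G.Adj e f → False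
  F4 : ∀ {a b c d e f : V}, G.Adj a b → ¬ G.Adj a c → ¬ G.Adj a d → ¬ G.Adj a e → G.Adj a f → G.Adj b c → ¬ G.Adj b d → ¬ G.Adj b e → G.Adj b f → G.Adj c d → G.Adj c e → G.Adj c f → G.Adj d e → ¬ G.Adj d f → G.Adj e f → False

theorem Free.deg {V : Type u} {G : SimpleGraph V} (H : Free G) {x y p q r : V}
    (hxy : G.Adj x y) (px : ¬ G.Adj p x) (py : ¬ G.Adj p y) (qx : ¬ G.Adj q x) (qy : ¬ G.Adj q y)
    (rx : ¬ G.Adj r x) (ry : ¬ G.Adj r y) (hpq : G.Adj p q) (hqr : G.Adj q r) : p = r := by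
  by_contra hne
  rcases em (G.Adj p r) with h | h
  · exact H.P2K3 hxy (ns px) (ns qx) (ns rx) (ns py) (ns qy) (ns ry) hpq h hqr
  · exact H.P3P2 hne hpq h px py hqr qx qy rx ry hxy

/-- The vertices anticomplete to an edge induce a 2-colourable graph. -/
theorem Free.two {V : Type u} [Fintype V] {G : SimpleGraph V} (H : Free G) {x y : V}
    (hxy : G.Adj x y) : ∃ g : V → Bool, ∀ p q, ¬ G.Adj p x → ¬ G.Adj p y → ¬ G.Adj q x →
      ¬ G.Adj q y → G.Adj p q → g p ≠ g q := by
  classical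
  let f := Fintype.equivFin V
  refine ⟨fun v => decide (∃ w, ¬ G.Adj w x ∧ ¬ G.Adj w y ∧ G.Adj v w ∧ f w < f v), ?_⟩
  have key : ∀ p q, ¬ G.Adj p x → ¬ G.Adj p y → ¬ G.Adj q x → ¬ G.Adj q y → G.Adj p q →
      f p < f q → (∃ w, ¬ G.Adj w x ∧ ¬ G.Adj w y ∧ G.Adj q w ∧ f w < f q) ∧
      ¬ (∃ w, ¬ G.Adj w x ∧ ¬ G.Adj w y ∧ G.Adj p w ∧ f w < f p) := by
    intro p q px py qx qy hpq hlt
    refine ⟨⟨p, px, py, hpq.symm, hlt⟩, ?_⟩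
    rintro ⟨w, wx, wy, hpw, hw⟩
    have := H.deg hxy qx qy px py wx wy hpq.symm hpw
    subst this
    exact lt_asymm hlt hw
  intro p q px py qx qy hpq
  have hne : f p ≠ f q := fun h => hpq.ne (f.injective h)
  rcases lt_or_gt_of_ne hne with hl | hl
  · obtain ⟨h1, h2⟩ := key p q px py qx qy hpq hl
    simp only [decide_eq_true h1, decide_eq_false h2]; decide
  · obtain ⟨h1, h2⟩ := key q p qx qy px py hpq.symm hl
    simp only [decide_eq_true h1, decide_eq_false h2]; decide

/-- A fixed induced hammer. -/
structure Ham {V : Type u} (G : SimpleGraph V) (a b c d e : V) : Prop where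
  hab : G.Adj a b
  hac : G.Adj a c
  kad : ¬ G.Adj a d
  kae : ¬ G.Adj a e
  hbc : G.Adj b c
  kbd : ¬ G.Adj b d
  kbe : ¬ G.Adj b e
  hcd : G.Adj c d
  kce : ¬ G.Adj c e
  hde : G.Adj d e

/-- Adjacent vertices `u`, `v` outside the hammer with a neighbour in `{d, e}` cannot both avoid the
neighbourhoods `{a, d}` and `{b, d}`. -/
theorem Free.rest {V : Type u} {G : SimpleGraph V} (H : Free G) {a b c d e u v : V}
    (Q : Ham G a b c d e)
    (ncu : c ≠ u) (ndu : d ≠ u) (neu : e ≠ u) (ncv : c ≠ v) (ndv : d ≠ v) (nev : e ≠ v)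
    (Hu1 : ¬ G.Adj d u → ¬ G.Adj e u → False)
    (Hu2 : G.Adj a u → ¬ G.Adj b u → ¬ G.Adj c u → G.Adj d u → ¬ G.Adj e u → False)
    (Hu3 : ¬ G.Adj a u → G.Adj b u → ¬ G.Adj c u → G.Adj d u → ¬ G.Adj e u → False)
    (Hv1 : ¬ G.Adj d v → ¬ G.Adj e v → False)
    (Hv2 : G.Adj a v → ¬ G.Adj b v → ¬ G.Adj c v → G.Adj d v → ¬ G.Adj e v → False)
    (Hv3 : ¬ G.Adj a v → G.Adj b v → ¬ G.Adj c v → G.Adj d v → ¬ G.Adj e v → False)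
    (huv : G.Adj u v) : False := by
  obtain ⟨hab, hac, kad, kae, hbc, kbd, kbe, hcd, kce, hde⟩ := Q
  have nau : a ≠ u := by rintro rfl; exact Hu1 (ns kad) (ns kae)
  have nbu : b ≠ u := by rintro rfl; exact Hu1 (ns kbd) (ns kbe)
  have nav : a ≠ v := by rintro rfl; exact Hv1 (ns kad) (ns kae)
  have nbv : b ≠ v := by rintro rfl; exact Hv1 (ns kbd) (ns kbe)
  rcases em (G.Adj a u) with hau | kau
  · rcases em (G.Adj a v) with hav | kav
    · rcases em (G.Adj b u) with hbu | kbu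
      · rcases em (G.Adj c u) with hcu | kcu
        · exact H.K4 hab hac hau hbc hbu hcu
        · rcases em (G.Adj b v) with hbv | kbv
          · exact H.K4 hab hau hav hbu hbv huv
          · rcases em (G.Adj c v) with hcv | kcv
            · exact H.W4 nbv ncu hbc kbv hbu hab.symm hcv kcu hac.symm huv.symm hav.symm hau.symm
            · rcases em (G.Adj d v) with hdv | kdv
              · rcases em (G.Adj e v) with hev | kev
                · exact H.F1 hab.symm kbv kbe kbd hbc hav kae kad hac hev.symm hdv.symm (ns kcv) hde.symm (ns kce) hcd.symm
                · exact Hv2 hav kbv kcv hdv kev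
              · rcases em (G.Adj e v) with hev | kev
                · exact H.F3 hab.symm kbv kbe kbd hbc hav kae kad hac hev.symm (ns kdv) (ns kcv) hde.symm (ns kce) hcd.symm
                · exact Hv1 kdv kev
      · rcases em (G.Adj c u) with hcu | kcu
        · rcases em (G.Adj c v) with hcv | kcv
          · exact H.K4 hac hau hav hcu hcv huv
          · rcases em (G.Adj b v) with hbv | kbv
            · exact H.W4 nbu ncv hbc kbu hbv hab.symm hcu kcv hac.symm huv hau.symm hav.symm
            · rcases em (G.Adj d v) with hdv | kdv
              · rcases em (G.Adj e v) with hev | kev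
                · exact H.F1 hab.symm kbv kbe kbd hbc hav kae kad hac hev.symm hdv.symm (ns kcv) hde.symm (ns kce) hcd.symm
                · exact Hv2 hav kbv kcv hdv kev
              · rcases em (G.Adj e v) with hev | kev
                · exact H.F3 hab.symm kbv kbe kbd hbc hav kae kad hac hev.symm (ns kdv) (ns kcv) hde.symm (ns kce) hcd.symm
                · exact Hv1 kdv kev
        · rcases em (G.Adj d u) with hdu | kdu
          · rcases em (G.Adj e u) with heu | keu
            · exact H.F1 hab.symm kbu kbe kbd hbc hau kae kad hac heu.symm hdu.symm (ns kcu) hde.symm (ns kce) hcd.symm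
            · exact Hu2 hau kbu kcu hdu keu
          · rcases em (G.Adj e u) with heu | keu
            · exact H.F3 hab.symm kbu kbe kbd hbc hau kae kad hac heu.symm (ns kdu) (ns kcu) hde.symm (ns kce) hcd.symm
            · exact Hu1 kdu keu
    · rcases em (G.Adj b v) with hbv | kbv
      · rcases em (G.Adj c v) with hcv | kcv
        · rcases em (G.Adj b u) with hbu | kbu
          · rcases em (G.Adj c u) with hcu | kcu
            · exact H.K4 hab hac hau hbc hbu hcu
            · exact H.W4 nav ncu hac kav hau hab hcv kcu hbc.symm huv.symm hbv.symm hbu.symm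
          · rcases em (G.Adj c u) with hcu | kcu
            · exact H.W4 nav nbu hab kav hau hac hbv kbu hbc huv.symm hcv.symm hcu.symm
            · rcases em (G.Adj d u) with hdu | kdu
              · rcases em (G.Adj e u) with heu | keu
                · exact H.F1 hab.symm kbu kbe kbd hbc hau kae kad hac heu.symm hdu.symm (ns kcu) hde.symm (ns kce) hcd.symm
                · exact Hu2 hau kbu kcu hdu keu
              · rcases em (G.Adj e u) with heu | keu
                · exact H.F3 hab.symm kbu kbe kbd hbc hau kae kad hac heu.symm (ns kdu) (ns kcu) hde.symm (ns kce) hcd.symm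
                · exact Hu1 kdu keu
        · rcases em (G.Adj d v) with hdv | kdv
          · rcases em (G.Adj e v) with hev | kev
            · exact H.F1 hab kav kae kad hac hbv kbe kbd hbc hev.symm hdv.symm (ns kcv) hde.symm (ns kce) hcd.symm
            · exact Hv3 kav hbv kcv hdv kev
          · rcases em (G.Adj e v) with hev | kev
            · exact H.F3 hab kav kae kad hac hbv kbe kbd hbc hev.symm (ns kdv) (ns kcv) hde.symm (ns kce) hcd.symm
            · exact Hv1 kdv kev
      · rcases em (G.Adj d v) with hdv | kdv
        · rcases em (G.Adj e v) with hev | kev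
          · exact H.P2K3 hab kad kae kav kbd kbe kbv hde hdv hev
          · exact H.P3P2 nev hde.symm kev (ns kae) (ns kbe) hdv (ns kad) (ns kbd) (ns kav) (ns kbv) hab
        · rcases em (G.Adj e v) with hev | kev
          · exact H.P3P2 ndv hde kdv (ns kad) (ns kbd) hev (ns kae) (ns kbe) (ns kav) (ns kbv) hab
          · exact Hv1 kdv kev
  · rcases em (G.Adj b u) with hbu | kbu
    · rcases em (G.Adj c u) with hcu | kcu
      · rcases em (G.Adj b v) with hbv | kbv
        · rcases em (G.Adj c v) with hcv | kcv
          · exact H.K4 hbc hbu hbv hcu hcv huv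
          · rcases em (G.Adj a v) with hav | kav
            · exact H.W4 nau ncv hac kau hav hab hcu kcv hbc.symm huv hbu.symm hbv.symm
            · rcases em (G.Adj d v) with hdv | kdv
              · rcases em (G.Adj e v) with hev | kev
                · exact H.F1 hab kav kae kad hac hbv kbe kbd hbc hev.symm hdv.symm (ns kcv) hde.symm (ns kce) hcd.symm
                · exact Hv3 kav hbv kcv hdv kev
              · rcases em (G.Adj e v) with hev | kev
                · exact H.F3 hab kav kae kad hac hbv kbe kbd hbc hev.symm (ns kdv) (ns kcv) hde.symm (ns kce) hcd.symm
                · exact Hv1 kdv kev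
        · rcases em (G.Adj a v) with hav | kav
          · rcases em (G.Adj c v) with hcv | kcv
            · exact H.W4 nau nbv hab kau hav hac hbu kbv hbc huv hcu.symm hcv.symm
            · rcases em (G.Adj d v) with hdv | kdv
              · rcases em (G.Adj e v) with hev | kev
                · exact H.F1 hab.symm kbv kbe kbd hbc hav kae kad hac hev.symm hdv.symm (ns kcv) hde.symm (ns kce) hcd.symm
                · exact Hv2 hav kbv kcv hdv kev
              · rcases em (G.Adj e v) with hev | kev
                · exact H.F3 hab.symm kbv kbe kbd hbc hav kae kad hac hev.symm (ns kdv) (ns kcv) hde.symm (ns kce) hcd.symm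
                · exact Hv1 kdv kev
          · rcases em (G.Adj d v) with hdv | kdv
            · rcases em (G.Adj e v) with hev | kev
              · exact H.P2K3 hab kad kae kav kbd kbe kbv hde hdv hev
              · exact H.P3P2 nev hde.symm kev (ns kae) (ns kbe) hdv (ns kad) (ns kbd) (ns kav) (ns kbv) hab
            · rcases em (G.Adj e v) with hev | kev
              · exact H.P3P2 ndv hde kdv (ns kad) (ns kbd) hev (ns kae) (ns kbe) (ns kav) (ns kbv) hab
              · exact Hv1 kdv kev
      · rcases em (G.Adj d u) with hdu | kdu
        · rcases em (G.Adj e u) with heu | keu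
          · exact H.F1 hab kau kae kad hac hbu kbe kbd hbc heu.symm hdu.symm (ns kcu) hde.symm (ns kce) hcd.symm
          · exact Hu3 kau hbu kcu hdu keu
        · rcases em (G.Adj e u) with heu | keu
          · exact H.F3 hab kau kae kad hac hbu kbe kbd hbc heu.symm (ns kdu) (ns kcu) hde.symm (ns kce) hcd.symm
          · exact Hu1 kdu keu
    · rcases em (G.Adj d u) with hdu | kdu
      · rcases em (G.Adj e u) with heu | keu
        · exact H.P2K3 hab kad kae kau kbd kbe kbu hde hdu heu
        · exact H.P3P2 neu hde.symm keu (ns kae) (ns kbe) hdu (ns kad) (ns kbd) (ns kau) (ns kbu) hab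
      · rcases em (G.Adj e u) with heu | keu
        · exact H.P3P2 ndu hde kdu (ns kad) (ns kbd) heu (ns kae) (ns kbe) (ns kau) (ns kbu) hab
        · exact Hu1 kdu keu

/-- An edge with both ends attached to `{a, d}` excludes an edge with both ends attached to
`{b, d}`. -/
theorem Free.cross {V : Type u} {G : SimpleGraph V} (H : Free G) {a b c d e u v w x : V}
    (Q : Ham G a b c d e)
    (hau : G.Adj a u) (kbu : ¬ G.Adj b u) (kcu : ¬ G.Adj c u) (hdu : G.Adj d u)
    (hav : G.Adj a v) (kbv : ¬ G.Adj b v) (kcv : ¬ G.Adj c v) (hdv : G.Adj d v)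
    (kaw : ¬ G.Adj a w) (hbw : G.Adj b w) (kcw : ¬ G.Adj c w) (hdw : G.Adj d w)
    (kax : ¬ G.Adj a x) (hbx : G.Adj b x) (kcx : ¬ G.Adj c x) (hdx : G.Adj d x)
    (huv : G.Adj u v) (hwx : G.Adj w x) : False := by
  obtain ⟨hab, hac, kad, kae, hbc, kbd, kbe, hcd, kce, hde⟩ := Q
  have nuw : u ≠ w := by rintro rfl; exact kaw hau
  have nux : u ≠ x := by rintro rfl; exact kax hau
  have nvw : v ≠ w := by rintro rfl; exact kaw hav
  have nvx : v ≠ x := by rintro rfl; exact kax hav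
  have ncu : c ≠ u := by rintro rfl; exact kbu hbc
  have ncv : c ≠ v := by rintro rfl; exact kbv hbc
  have ncw : c ≠ w := by rintro rfl; exact kaw hac
  have ncx : c ≠ x := by rintro rfl; exact kax hac
  rcases em (G.Adj u w) with huw | kuw
  · rcases em (G.Adj u x) with hux | kux
    · exact H.K4 hdu hdw hdx huw hux hwx
    · rcases em (G.Adj v w) with hvw | kvw
      · exact H.K4 hdu hdv hdw huv huw hvw
      · rcases em (G.Adj v x) with hvx | kvx
        · exact H.W4 nux nvw huv kux huw hdu.symm hvx kvw hdv.symm hwx.symm hdx.symm hdw.symm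
        · exact H.P3P2 ncv hac.symm kcv kcw kcx hav kaw kax kvw kvx hwx
  · rcases em (G.Adj u x) with hux | kux
    · rcases em (G.Adj v w) with hvw | kvw
      · rcases em (G.Adj v x) with hvx | kvx
        · exact H.K4 hdu hdv hdx huv hux hvx
        · exact H.W4 nuw nvx huv kuw hux hdu.symm hvw kvx hdv.symm hwx hdw.symm hdx.symm
      · exact H.P3P2 ncw hbc.symm kcw kcu kcv hbw kbu kbv (ns kuw) (ns kvw) huv
    · exact H.P3P2 ncu hac.symm kcu kcw kcx hau kaw kax kuw kux hwx

/-- The colouring when the vertices attached to `{b, d}` form a stable set. -/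
theorem Free.color {V : Type u} [Fintype V] {G : SimpleGraph V} (H : Free G) {a b c d e : V}
    (Q : Ham G a b c d e)
    (hN : ∀ w x, ¬ G.Adj a w → G.Adj b w → ¬ G.Adj c w → G.Adj d w → ¬ G.Adj e w →
      ¬ G.Adj a x → G.Adj b x → ¬ G.Adj c x → G.Adj d x → ¬ G.Adj e x → ¬ G.Adj w x) :
    G.Colorable 6 := by
  classical
  obtain ⟨g, hg⟩ := H.two Q.hde
  obtain ⟨m, hm⟩ := H.two Q.hbc
  let A : V → Prop := fun v => ¬ G.Adj d v ∧ ¬ G.Adj e v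
  let M : V → Prop := fun v =>
    G.Adj a v ∧ ¬ G.Adj b v ∧ ¬ G.Adj c v ∧ G.Adj d v ∧ ¬ G.Adj e v
  let N : V → Prop := fun v =>
    ¬ G.Adj a v ∧ G.Adj b v ∧ ¬ G.Adj c v ∧ G.Adj d v ∧ ¬ G.Adj e v
  let col : V → Fin 6 := fun v =>
    if A v then (if g v then 0 else 1)
    else if v = d then 0
    else if v = c ∨ v = e ∨ N v then 2
    else if M v then (if m v then 3 else 4)
    else 5
  have cA : ∀ v, A v → (col v = 0 ∧ g v = true) ∨ (col v = 1 ∧ g v = false) := by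
    intro v h
    cases hgv : g v <;> simp [col, h, hgv]
  have cd : ∀ v, ¬ A v → v = d → col v = 0 := by
    intro v h1 h2
    simp only [col, if_neg h1, if_pos h2]
  have cN : ∀ v, ¬ A v → v ≠ d → (v = c ∨ v = e ∨ N v) → col v = 2 := by
    intro v h1 h2 h3
    simp only [col, if_neg h1, if_neg h2, if_pos h3]
  have cM : ∀ v, ¬ A v → v ≠ d → ¬ (v = c ∨ v = e ∨ N v) → M v →
      (col v = 3 ∧ m v = true) ∨ (col v = 4 ∧ m v = false) := by
    intro v h1 h2 h3 h4
    cases hmv : m v <;> simp only [col, if_neg h1, if_neg h2, if_neg h3, if_pos h4, hmv] <;> simp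
  have cS : ∀ v, ¬ A v → v ≠ d → ¬ (v = c ∨ v = e ∨ N v) → ¬ M v → col v = 5 := by
    intro v h1 h2 h3 h4
    simp only [col, if_neg h1, if_neg h2, if_neg h3, if_neg h4]
  have cls : ∀ v, (A v ∧ ((col v = 0 ∧ g v = true) ∨ (col v = 1 ∧ g v = false))) ∨
      (v = d ∧ col v = 0) ∨ ((v = c ∨ v = e ∨ N v) ∧ col v = 2) ∨
      (M v ∧ ((col v = 3 ∧ m v = true) ∨ (col v = 4 ∧ m v = false))) ∨
      (¬ A v ∧ v ≠ d ∧ v ≠ c ∧ v ≠ e ∧ ¬ N v ∧ ¬ M v ∧ col v = 5) := by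
    intro v
    by_cases h1 : A v
    · exact Or.inl ⟨h1, cA v h1⟩
    by_cases h2 : v = d
    · exact Or.inr (Or.inl ⟨h2, cd v h1 h2⟩)
    by_cases h3 : v = c ∨ v = e ∨ N v
    · exact Or.inr (Or.inr (Or.inl ⟨h3, cN v h1 h2 h3⟩))
    by_cases h4 : M v
    · exact Or.inr (Or.inr (Or.inr (Or.inl ⟨h4, cM v h1 h2 h3 h4⟩)))
    · exact Or.inr (Or.inr (Or.inr (Or.inr ⟨h1, h2, fun h => h3 (Or.inl h),
        fun h => h3 (Or.inr (Or.inl h)), fun h => h3 (Or.inr (Or.inr h)), h4, cS v h1 h2 h3 h4⟩)))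
  refine ⟨Coloring.mk col ?_⟩
  intro u v huv heq
  have hA : A u → A v → g u ≠ g v := fun hu hv =>
    hg u v (ns hu.1) (ns hu.2) (ns hv.1) (ns hv.2) huv
  have hM : M u → M v → m u ≠ m v := fun hu hv =>
    hm u v (ns hu.2.1) (ns hu.2.2.1) (ns hv.2.1) (ns hv.2.2.1) huv
  have hNN : ∀ u v, G.Adj u v → (u = c ∨ u = e ∨ N u) → (v = c ∨ v = e ∨ N v) → False := by
    rintro u v huv (rfl | rfl | hu) (rfl | rfl | hv)
    · exact huv.ne rfl
    · exact Q.kce huv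
    · exact hv.2.2.1 huv
    · exact Q.kce huv.symm
    · exact huv.ne rfl
    · exact hv.2.2.2.2 huv
    · exact hu.2.2.1 huv.symm
    · exact hu.2.2.2.2 huv.symm
    · exact hN u v hu.1 hu.2.1 hu.2.2.1 hu.2.2.2.1 hu.2.2.2.2
        hv.1 hv.2.1 hv.2.2.1 hv.2.2.2.1 hv.2.2.2.2 huv
  have hS : ¬ A u → u ≠ d → u ≠ c → u ≠ e → ¬ N u → ¬ M u →
      ¬ A v → v ≠ d → v ≠ c → v ≠ e → ¬ N v → ¬ M v → False := by
    intro u1 u2 u3 u4 u5 u6 v1 v2 v3 v4 v5 v6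
    exact H.rest Q u3.symm u2.symm u4.symm v3.symm v2.symm v4.symm
      (fun h1 h2 => u1 ⟨h1, h2⟩) (fun h1 h2 h3 h4 h5 => u6 ⟨h1, h2, h3, h4, h5⟩)
      (fun h1 h2 h3 h4 h5 => u5 ⟨h1, h2, h3, h4, h5⟩)
      (fun h1 h2 => v1 ⟨h1, h2⟩) (fun h1 h2 h3 h4 h5 => v6 ⟨h1, h2, h3, h4, h5⟩)
      (fun h1 h2 h3 h4 h5 => v5 ⟨h1, h2, h3, h4, h5⟩) huv
  have hd1 : u = d → ¬ A v := by rintro rfl hv; exact hv.1 huv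
  have hd2 : v = d → ¬ A u := by rintro rfl hu; exact hu.1 huv.symm
  have hdd : u = d → v ≠ d := by rintro rfl rfl; exact huv.ne rfl
  have hNN' := hNN u v huv
  have hu := cls u
  have hv := cls v
  rw [← heq] at hv
  clear_value col A M N
  rcases hu with ⟨hu, ⟨h0, h1⟩ | ⟨h0, h1⟩⟩ | ⟨hu, h0⟩ | ⟨hu, h0⟩ |
      ⟨hu, ⟨h0, h1⟩ | ⟨h0, h1⟩⟩ | ⟨u1, u2, u3, u4, u5, u6, h0⟩ <;>
    simp [h0] at hv
  · rcases hv with ⟨hv, h2⟩ | hv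
    · exact hA hu hv (h1.trans h2.symm)
    · exact hd2 hv hu
  · exact hA hu hv.1 (h1.trans hv.2.symm)
  · rcases hv with ⟨hv, h2⟩ | hv
    · exact hd1 hu hv
    · exact hdd hu hv
  · exact hNN' hu hv
  · exact hM hu hv.1 (h1.trans hv.2.symm)
  · exact hM hu hv.1 (h1.trans hv.2.symm)
  · exact hS u1 u2 u3 u4 u5 u6 hv.1 hv.2.1 hv.2.2.1 hv.2.2.2.1 hv.2.2.2.2.1 hv.2.2.2.2.2

end Hammer

set_option maxHeartbeats 4000000 in
theorem stmt18 {V : Type*} [Fintype V] (G : SimpleGraph V)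
    (hP : IsEmpty (P3P2 ↪g G)) (hW : IsEmpty (W4 ↪g G)) (hK4 : G.CliqueFree 4)
    (hP2K3 : IsEmpty (P2K3 ↪g G)) (hF1 : IsEmpty (F1 ↪g G)) (hF2 : IsEmpty (F2 ↪g G))
    (hF3 : IsEmpty (F3 ↪g G)) (hF4 : IsEmpty (F4 ↪g G))
    (hQ : Nonempty (hammer ↪g G)) :
    G.chromaticNumber ≤ 6 := by
  have H : Hammer.Free G := by
    refine ⟨?_, ?_, ?_, ?_, ?_, ?_, ?_, ?_⟩
    · intro a b c d e t0 h0 h1 h2 h3 h4 h5 h6 h7 h8 h9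
      refine Hammer.emb hP ![a, b, c, d, e] ?_
      intro i j hij
      constructor
      · fin_cases i <;> fin_cases j <;> first | (exact absurd hij (by decide)) | skip
        all_goals
          simp
          rintro rfl
          simp_all [G.adj_comm]
      · fin_cases i <;> fin_cases j <;> first | (exact absurd hij (by decide)) | skip
        all_goals simp [P3P2, *]
    · intro a b c d e t0 t1 h0 h1 h2 h3 h4 h5 h6 h7 h8 h9
      refine Hammer.emb hW ![a, b, c, d, e] ?_
      intro i j hij
      constructor
      · fin_cases i <;> fin_cases j <;> first | (exact absurd hij (by decide)) | skip
        all_goals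
          simp
          rintro rfl
          simp_all [G.adj_comm]
      · fin_cases i <;> fin_cases j <;> first | (exact absurd hij (by decide)) | skip
        all_goals simp [W4, *]
    · intro a b c d h0 h1 h2 h3 h4 h5
      classical
      refine hK4 {a, b, c, d} ?_
      have e0 := h0.ne
      have e1 := h1.ne
      have e2 := h2.ne
      have e3 := h3.ne
      have e4 := h4.ne
      have e5 := h5.ne
      rw [isNClique_iff]
      constructor
      · simp [IsClique, Set.Pairwise, h0, h1, h2, h3, h4, h5, h0.symm, h1.symm, h2.symm, h3.symm,
          h4.symm, h5.symm]
      · simp [e0, e1, e2, e3, e4, e5]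
    · intro a b c d e  h0 h1 h2 h3 h4 h5 h6 h7 h8 h9
      refine Hammer.emb hP2K3 ![a, b, c, d, e] ?_
      intro i j hij
      constructor
      · fin_cases i <;> fin_cases j <;> first | (exact absurd hij (by decide)) | skip
        all_goals
          simp
          rintro rfl
          simp_all [G.adj_comm]
      · fin_cases i <;> fin_cases j <;> first | (exact absurd hij (by decide)) | skip
        all_goals simp [P2K3, *]
    · intro a b c d e f  h0 h1 h2 h3 h4 h5 h6 h7 h8 h9 h10 h11 h12 h13 h14
      refine Hammer.emb hF1 ![a, b, c, d, e, f] ?_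
      intro i j hij
      constructor
      · fin_cases i <;> fin_cases j <;> first | (exact absurd hij (by decide)) | skip
        all_goals
          simp
          rintro rfl
          simp_all [G.adj_comm]
      · fin_cases i <;> fin_cases j <;> first | (exact absurd hij (by decide)) | skip
        all_goals simp [F1, *]
    · intro a b c d e f  h0 h1 h2 h3 h4 h5 h6 h7 h8 h9 h10 h11 h12 h13 h14
      refine Hammer.emb hF2 ![a, b, c, d, e, f] ?_
      intro i j hij
      constructor
      · fin_cases i <;> fin_cases j <;> first | (exact absurd hij (by decide)) | skip
        all_goals
          simp
          rintro rfl
          simp_all [G.adj_comm]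
      · fin_cases i <;> fin_cases j <;> first | (exact absurd hij (by decide)) | skip
        all_goals simp [F2, *]
    · intro a b c d e f  h0 h1 h2 h3 h4 h5 h6 h7 h8 h9 h10 h11 h12 h13 h14
      refine Hammer.emb hF3 ![a, b, c, d, e, f] ?_
      intro i j hij
      constructor
      · fin_cases i <;> fin_cases j <;> first | (exact absurd hij (by decide)) | skip
        all_goals
          simp
          rintro rfl
          simp_all [G.adj_comm]
      · fin_cases i <;> fin_cases j <;> first | (exact absurd hij (by decide)) | skip
        all_goals simp [F3, *]
    · intro a b c d e f  h0 h1 h2 h3 h4 h5 h6 h7 h8 h9 h10 h11 h12 h13 h14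
      refine Hammer.emb hF4 ![a, b, c, d, e, f] ?_
      intro i j hij
      constructor
      · fin_cases i <;> fin_cases j <;> first | (exact absurd hij (by decide)) | skip
        all_goals
          simp
          rintro rfl
          simp_all [G.adj_comm]
      · fin_cases i <;> fin_cases j <;> first | (exact absurd hij (by decide)) | skip
        all_goals simp [F4, *]
  obtain ⟨q⟩ := hQ
  have Q : Hammer.Ham G (q 0) (q 1) (q 2) (q 3) (q 4) := by
    constructor <;> rw [q.map_adj_iff] <;> simp [hammer]
  suffices h : G.Colorable 6 from h.chromaticNumber_le
  by_cases hN : ∀ w x, ¬ G.Adj (q 0) w → G.Adj (q 1) w → ¬ G.Adj (q 2) w → G.Adj (q 3) w →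
      ¬ G.Adj (q 4) w → ¬ G.Adj (q 0) x → G.Adj (q 1) x → ¬ G.Adj (q 2) x → G.Adj (q 3) x →
      ¬ G.Adj (q 4) x → ¬ G.Adj w x
  · exact H.color Q hN
  · push Not at hN
    obtain ⟨w, x, w0, w1, w2, w3, w4, x0, x1, x2, x3, x4, hwx⟩ := hN
    have Q' : Hammer.Ham G (q 1) (q 0) (q 2) (q 3) (q 4) :=
      ⟨Q.hab.symm, Q.hbc, Q.kbd, Q.kbe, Q.hac, Q.kad, Q.kae, Q.hcd, Q.kce, Q.hde⟩
    refine H.color Q' ?_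
    intro u v u1 u0 u2 u3 u4 v1 v0 v2 v3 v4 huv
    exact H.cross Q u0 u1 u2 u3 v0 v1 v2 v3 w0 w1 w2 w3 x0 x1 x2 x3 huv hwx
end

section
/- Let G be a finite simple graph that is (P3∪P2)-free, W4-free, K4-free, (P2∪K3)-free, F1-free, F2-free, F3-free, F4-free and hammer-free. If G contains an induced subgraph isomorphic to K1∪K3 (the disjoint union of an isolated vertex and a triangle), then χ(G) ≤ 6. -/
open SimpleGraph

/-- `K1 ∪ K3`: disjoint union of an isolated vertex (0) and a triangle (1,2,3). -/
def K1K3 : SimpleGraph (Fin 4) :=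
  SimpleGraph.fromEdgeSet {s(1,2), s(2,3), s(1,3)}

section Aux

variable {V : Type*} (G : SimpleGraph V)

/-- Build an induced copy of a five-vertex graph from the pairwise relations. -/
theorem aux_emb (H : SimpleGraph (Fin 5)) (hE : IsEmpty (H ↪g G)) {a b c d e : V}
    (n01 : a ≠ b) (e01 : G.Adj a b ↔ H.Adj 0 1)
    (n02 : a ≠ c) (e02 : G.Adj a c ↔ H.Adj 0 2)
    (n03 : a ≠ d) (e03 : G.Adj a d ↔ H.Adj 0 3)
    (n04 : a ≠ e) (e04 : G.Adj a e ↔ H.Adj 0 4)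
    (n12 : b ≠ c) (e12 : G.Adj b c ↔ H.Adj 1 2)
    (n13 : b ≠ d) (e13 : G.Adj b d ↔ H.Adj 1 3)
    (n14 : b ≠ e) (e14 : G.Adj b e ↔ H.Adj 1 4)
    (n23 : c ≠ d) (e23 : G.Adj c d ↔ H.Adj 2 3)
    (n24 : c ≠ e) (e24 : G.Adj c e ↔ H.Adj 2 4)
    (n34 : d ≠ e) (e34 : G.Adj d e ↔ H.Adj 3 4) : False := by
  have key : ∀ i j : Fin 5, i < j → ![a, b, c, d, e] i ≠ ![a, b, c, d, e] j ∧
      (G.Adj (![a, b, c, d, e] i) (![a, b, c, d, e] j) ↔ H.Adj i j) := by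
    intro i j hij
    fin_cases i <;> fin_cases j <;> first
      | exact absurd hij (by decide)
      | exact ⟨n01, e01⟩
      | exact ⟨n02, e02⟩
      | exact ⟨n03, e03⟩
      | exact ⟨n04, e04⟩
      | exact ⟨n12, e12⟩
      | exact ⟨n13, e13⟩
      | exact ⟨n14, e14⟩
      | exact ⟨n23, e23⟩
      | exact ⟨n24, e24⟩
      | exact ⟨n34, e34⟩
  refine hE.false ⟨⟨![a, b, c, d, e], ?_⟩, ?_⟩
  · intro i j hij
    rcases lt_trichotomy i j with h | h | h
    · exact absurd hij (key i j h).1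
    · exact h
    · exact absurd hij.symm (key j i h).1
  · intro i j
    rcases lt_trichotomy i j with h | h | h
    · exact (key i j h).2
    · subst h
      simp
    · rw [G.adj_comm, H.adj_comm]
      exact (key j i h).2

/-- Elementary form of `P3 ∪ P2`-freeness. -/
theorem aux_noP (hP : IsEmpty (P3P2 ↪g G)) {a b c d e : V} (hac : a ≠ c)
    (h01 : G.Adj a b) (h12 : G.Adj b c) (h34 : G.Adj d e)
    (h02 : ¬ G.Adj a c) (h03 : ¬ G.Adj a d) (h04 : ¬ G.Adj a e)
    (h13 : ¬ G.Adj b d) (h14 : ¬ G.Adj b e) (h23 : ¬ G.Adj c d) (h24 : ¬ G.Adj c e) : False := by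
  apply aux_emb G P3P2 hP (a := a) (b := b) (c := c) (d := d) (e := e)
  all_goals first
    | (rintro rfl; grind [SimpleGraph.adj_comm, SimpleGraph.irrefl])
    | (simp only [P3P2, SimpleGraph.fromEdgeSet_adj]; simp; grind [SimpleGraph.adj_comm])

/-- Elementary form of `W4`-freeness. -/
theorem aux_noW (hW : IsEmpty (W4 ↪g G)) {a b c d e : V} (hac : a ≠ c) (hbd : b ≠ d)
    (h01 : G.Adj a b) (h12 : G.Adj b c) (h23 : G.Adj c d) (h30 : G.Adj d a)
    (h40 : G.Adj e a) (h41 : G.Adj e b) (h42 : G.Adj e c) (h43 : G.Adj e d)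
    (h02 : ¬ G.Adj a c) (h13 : ¬ G.Adj b d) : False := by
  apply aux_emb G W4 hW (a := a) (b := b) (c := c) (d := d) (e := e)
  all_goals first
    | (rintro rfl; grind [SimpleGraph.adj_comm, SimpleGraph.irrefl])
    | (simp only [W4, SimpleGraph.fromEdgeSet_adj]; simp; grind [SimpleGraph.adj_comm])

/-- Elementary form of `P2 ∪ K3`-freeness. -/
theorem aux_noPK (hPK : IsEmpty (P2K3 ↪g G)) {a b c d e : V}
    (h01 : G.Adj a b) (h23 : G.Adj c d) (h34 : G.Adj d e) (h24 : G.Adj c e)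
    (h02 : ¬ G.Adj a c) (h03 : ¬ G.Adj a d) (h04 : ¬ G.Adj a e)
    (h12 : ¬ G.Adj b c) (h13 : ¬ G.Adj b d) (h14 : ¬ G.Adj b e) : False := by
  apply aux_emb G P2K3 hPK (a := a) (b := b) (c := c) (d := d) (e := e)
  all_goals first
    | (rintro rfl; grind [SimpleGraph.adj_comm, SimpleGraph.irrefl])
    | (simp only [P2K3, SimpleGraph.fromEdgeSet_adj]; simp; grind [SimpleGraph.adj_comm])

/-- Elementary form of hammer-freeness. -/
theorem aux_noH (hH : IsEmpty (hammer ↪g G)) {a b c d e : V}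
    (h01 : G.Adj a b) (h12 : G.Adj b c) (h02 : G.Adj a c) (h23 : G.Adj c d) (h34 : G.Adj d e)
    (h03 : ¬ G.Adj a d) (h04 : ¬ G.Adj a e) (h13 : ¬ G.Adj b d) (h14 : ¬ G.Adj b e)
    (h24 : ¬ G.Adj c e) : False := by
  apply aux_emb G hammer hH (a := a) (b := b) (c := c) (d := d) (e := e)
  all_goals first
    | (rintro rfl; grind [SimpleGraph.adj_comm, SimpleGraph.irrefl])
    | (simp only [hammer, SimpleGraph.fromEdgeSet_adj]; simp; grind [SimpleGraph.adj_comm])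

/-- Elementary form of `K4`-freeness. -/
theorem aux_noK (hK : G.CliqueFree 4) {a b c d : V}
    (h01 : G.Adj a b) (h02 : G.Adj a c) (h03 : G.Adj a d) (h12 : G.Adj b c)
    (h13 : G.Adj b d) (h23 : G.Adj c d) : False := by
  classical
  refine hK {a, b, c, d} ?_
  have e : G.IsNClique 3 {b, c, d} := SimpleGraph.is3Clique_triple_iff.2 ⟨h12, h13, h23⟩
  refine e.insert ?_
  intro x hx
  simp only [Finset.mem_insert, Finset.mem_singleton] at hx
  rcases hx with rfl | rfl | rfl <;> assumption

/-- A cover by six independent sets gives a proper colouring with six colours. -/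
theorem aux_color (S : Fin 6 → V → Prop) (hc : ∀ v, ∃ i, S i v)
    (hi : ∀ i v w, S i v → S i w → ¬ G.Adj v w) : G.Colorable 6 := by
  choose f hf using hc
  exact ⟨SimpleGraph.Coloring.mk f (fun {v w} h e => hi (f v) v w (hf v) (e ▸ hf w) h)⟩

/-- Version of `aux_color` with the six sets given separately. -/
theorem aux_color6 (S0 S1 S2 S3 S4 S5 : V → Prop)
    (hc : ∀ v, S0 v ∨ S1 v ∨ S2 v ∨ S3 v ∨ S4 v ∨ S5 v)
    (h0 : ∀ v w, S0 v → S0 w → ¬ G.Adj v w) (h1 : ∀ v w, S1 v → S1 w → ¬ G.Adj v w)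
    (h2 : ∀ v w, S2 v → S2 w → ¬ G.Adj v w) (h3 : ∀ v w, S3 v → S3 w → ¬ G.Adj v w)
    (h4 : ∀ v w, S4 v → S4 w → ¬ G.Adj v w) (h5 : ∀ v w, S5 v → S5 w → ¬ G.Adj v w) :
    G.Colorable 6 := by
  refine aux_color G ![S0, S1, S2, S3, S4, S5] ?_ ?_
  · intro v
    rcases hc v with h | h | h | h | h | h
    exacts [⟨0, h⟩, ⟨1, h⟩, ⟨2, h⟩, ⟨3, h⟩, ⟨4, h⟩, ⟨5, h⟩]
  · intro i
    fin_cases i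
    exacts [h0, h1, h2, h3, h4, h5]

/-- `v` is adjacent to `a` only, among the triangle `a, b, c`. -/
def AuxA (a b c v : V) : Prop := G.Adj v a ∧ ¬ G.Adj v b ∧ ¬ G.Adj v c

/-- A set in which every vertex has at most one neighbour is bipartite. -/
theorem aux_split [Finite V] (A : V → Prop)
    (h : ∀ a b c, A a → A b → A c → G.Adj a b → G.Adj b c → a = c) :
    ∃ Q : V → Prop, (∀ v w, A v → A w → Q v → Q w → ¬ G.Adj v w) ∧
      (∀ v w, A v → A w → ¬ Q v → ¬ Q w → ¬ G.Adj v w) := by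
  obtain ⟨n, ⟨e⟩⟩ := Finite.exists_equiv_fin V
  refine ⟨fun v => ∃ w, A w ∧ G.Adj v w ∧ e w < e v, ?_, ?_⟩
  · rintro v w hv hw ⟨v', hv', h1, h2⟩ ⟨w', hw', h3, h4⟩ hvw
    have e1 : v' = w := h v' v w hv' hv hw h1.symm hvw
    have e2 : w' = v := h w' w v hw' hw hv h3.symm hvw.symm
    subst e1 e2
    exact absurd h2 (not_lt.2 h4.le)
  · intro v w hv hw h1 h2 hvw
    rcases lt_trichotomy (e v) (e w) with h3 | h3 | h3
    · exact h2 ⟨v, hv, hvw.symm, h3⟩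
    · exact hvw.ne (e.injective h3)
    · exact h1 ⟨w, hw, hvw, h3⟩

/-- Vertices attached to one vertex of the triangle induce a graph of maximum degree one. -/
theorem aux_match (hP : IsEmpty (P3P2 ↪g G)) (hK : G.CliqueFree 4) {p q r : V}
    (hqr : G.Adj q r) (a b c : V)
    (ha : AuxA G p q r a) (hb : AuxA G p q r b) (hc : AuxA G p q r c)
    (hab : G.Adj a b) (hbc : G.Adj b c) : a = c := by
  obtain ⟨ha1, ha2, ha3⟩ := ha
  obtain ⟨hb1, hb2, hb3⟩ := hb
  obtain ⟨hc1, hc2, hc3⟩ := hc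
  by_contra hne
  by_cases hac : G.Adj a c
  · exact aux_noK G hK ha1.symm hb1.symm hc1.symm hab hac hbc
  · exact aux_noP G hP hne hab hbc hqr hac ha2 ha3 hb2 hb3 hc2 hc3

/-- Vertices with no neighbour in the triangle are anticomplete to those with exactly one. -/
theorem aux_DA (hH : IsEmpty (hammer ↪g G)) {p q r d a : V} (hpq : G.Adj p q) (hpr : G.Adj p r)
    (hqr : G.Adj q r) (hd1 : ¬ G.Adj d p) (hd2 : ¬ G.Adj d q) (hd3 : ¬ G.Adj d r)
    (ha : AuxA G p q r a) : ¬ G.Adj d a := fun h =>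
  aux_noH G hH hqr hpr.symm hpq.symm ha.1.symm h.symm (fun k => ha.2.1 k.symm)
    (fun k => hd2 k.symm) (fun k => ha.2.2 k.symm) (fun k => hd3 k.symm) (fun k => hd1 k.symm)

/-- Classes `B_pq` and `B_pr` are anticomplete. -/
theorem aux_BB (hW : IsEmpty (W4 ↪g G)) {p q r a b : V} (hpq : G.Adj p q) (hpr : G.Adj p r)
    (hqr : G.Adj q r) (har : a ≠ r) (hbq : b ≠ q)
    (ha1 : G.Adj a p) (ha2 : G.Adj a q) (ha3 : ¬ G.Adj a r)
    (hb1 : G.Adj b p) (hb2 : ¬ G.Adj b q) (hb3 : G.Adj b r) : ¬ G.Adj a b := fun h =>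
  aux_noW G hW (a := q) (b := r) (c := b) (d := a) (e := p) hbq.symm har.symm hqr hb3.symm h.symm
    ha2 hpq hpr hb1.symm ha1.symm (fun k => hb2 k.symm) (fun k => ha3 k.symm)

/-- A vertex of `B_pq` has at most one neighbour on an edge in `A_p`. -/
theorem aux_le (hK : G.CliqueFree 4) {p q r u b c : V} (hu : G.Adj u p)
    (hb : AuxA G p q r b) (hc : AuxA G p q r c) (h1 : G.Adj b u) (h2 : G.Adj c u) :
    ¬ G.Adj b c := fun h =>
  aux_noK G hK hu.symm hb.1.symm hc.1.symm h1.symm h2.symm h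

/-- A vertex of `B_pq` has at least one neighbour on an edge in `A_p`. -/
theorem aux_ge (hP : IsEmpty (P3P2 ↪g G)) {p q r u b c : V} (hqr : G.Adj q r) (hur : u ≠ r)
    (hu2 : G.Adj u q) (hu3 : ¬ G.Adj u r)
    (hb : AuxA G p q r b) (hc : AuxA G p q r c) (h1 : ¬ G.Adj b u) (h2 : ¬ G.Adj c u) :
    ¬ G.Adj b c := fun h =>
  aux_noP G hP (a := r) (b := q) (c := u) (d := b) (e := c) hur.symm hqr.symm hu2.symm h
    (fun k => hu3 k.symm) (fun k => hb.2.2 k.symm) (fun k => hc.2.2 k.symm)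
    (fun k => hb.2.1 k.symm) (fun k => hc.2.1 k.symm) (fun k => h1 k.symm) (fun k => h2 k.symm)

/-- Neighbours of `u ∈ B_pq` in `A_p` and in `A_q` are pairwise nonadjacent. -/
theorem aux_cross (hW : IsEmpty (W4 ↪g G)) {p q r u b d : V} (hpq : G.Adj p q) (hpr : G.Adj p r)
    (hqr : G.Adj q r) (hu1 : G.Adj u p) (hu2 : G.Adj u q)
    (hb : AuxA G p q r b) (hd : AuxA G q p r d) (h1 : G.Adj b u) (h2 : G.Adj d u) :
    ¬ G.Adj b d := fun h =>
  aux_noW G hW (a := p) (b := q) (c := d) (d := b) (e := u)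
    (fun k => hd.2.2 (k ▸ hpr)) (fun k => hb.2.2 (k ▸ hqr)) hpq hd.1.symm h.symm hb.1
    hu1 hu2 h2.symm h1.symm (fun k => hd.2.1 k.symm) (fun k => hb.2.1 k.symm)

end Aux

/-- The case where some vertex `u` outside the triangle is adjacent to exactly `p` and `q`. -/
theorem aux_caseB {V : Type*} [Finite V] (G : SimpleGraph V)
    (hP : IsEmpty (P3P2 ↪g G)) (hW : IsEmpty (W4 ↪g G)) (hK : G.CliqueFree 4)
    (hPK : IsEmpty (P2K3 ↪g G)) (hH : IsEmpty (hammer ↪g G)) {p q r u : V}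
    (hpq : G.Adj p q) (hpr : G.Adj p r) (hqr : G.Adj q r)
    (hu1 : G.Adj u p) (hu2 : G.Adj u q) (hu3 : ¬ G.Adj u r) (hur : u ≠ r) : G.Colorable 6 := by
  obtain ⟨Q, hQ1, hQ2⟩ := aux_split G (AuxA G r p q) (aux_match G hP hK hpq)
  have hD : ∀ v w, (¬ G.Adj v p ∧ ¬ G.Adj v q ∧ ¬ G.Adj v r) →
      (¬ G.Adj w p ∧ ¬ G.Adj w q ∧ ¬ G.Adj w r) → ¬ G.Adj v w := by
    rintro v w ⟨a, b, c⟩ ⟨d, e, f⟩ h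
    exact aux_noPK G hPK h hpq hqr hpr a b c d e f
  have hK' : ∀ v, G.Adj v p → G.Adj v q → G.Adj v r → False := fun v a b c =>
    aux_noK G hK a b c hpq hpr hqr
  have hDA : ∀ v w, (¬ G.Adj v p ∧ ¬ G.Adj v q ∧ ¬ G.Adj v r) → AuxA G p q r w →
      ¬ G.Adj v w := fun v w hv hw => aux_DA G hH hpq hpr hqr hv.1 hv.2.1 hv.2.2 hw
  refine aux_color6 G
    (fun v => v = r ∨ (¬ G.Adj v p ∧ ¬ G.Adj v q ∧ ¬ G.Adj v r) ∨ (AuxA G p q r v ∧ ¬ G.Adj v u))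
    (fun v => v = p ∨ (AuxA G q p r v ∧ ¬ G.Adj v u))
    (fun v => (AuxA G p q r v ∧ G.Adj v u) ∨ (AuxA G q p r v ∧ G.Adj v u))
    (fun v => v = q ∨ (AuxA G r p q v ∧ Q v))
    (fun v => AuxA G r p q v ∧ ¬ Q v)
    (fun v => v ≠ p ∧ v ≠ q ∧ v ≠ r ∧ ((G.Adj v p ∧ G.Adj v q ∧ ¬ G.Adj v r) ∨
      (G.Adj v p ∧ ¬ G.Adj v q ∧ G.Adj v r) ∨ (¬ G.Adj v p ∧ G.Adj v q ∧ G.Adj v r)))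
    ?_ ?_ ?_ ?_ ?_ ?_ ?_
  · intro v
    have := hK' v
    clear hD hDA hQ1 hQ2
    simp only [AuxA]
    grind
  · rintro v w (rfl | hv | ⟨hv, hv'⟩) (rfl | hw | ⟨hw, hw'⟩) h
    · exact G.irrefl h
    · exact hw.2.2 h.symm
    · exact hw.2.2 h.symm
    · exact hv.2.2 h
    · exact hD v w hv hw h
    · exact hDA v w hv hw h
    · exact hv.2.2 h
    · exact hDA w v hw hv h.symm
    · exact aux_ge G hP hqr hur hu2 hu3 hv hw hv' hw' h
  · rintro v w (rfl | ⟨hv, hv'⟩) (rfl | ⟨hw, hw'⟩) h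
    · exact G.irrefl h
    · exact hw.2.1 h.symm
    · exact hv.2.1 h
    · exact aux_ge G hP hpr hur hu1 hu3 hv hw hv' hw' h
  · rintro v w (⟨hv, hv'⟩ | ⟨hv, hv'⟩) (⟨hw, hw'⟩ | ⟨hw, hw'⟩) h
    · exact aux_le G hK hu1 hv hw hv' hw' h
    · exact aux_cross G hW hpq hpr hqr hu1 hu2 hv hw hv' hw' h
    · exact aux_cross G hW hpq hpr hqr hu1 hu2 hw hv hw' hv' h.symm
    · exact aux_le G hK hu2 hv hw hv' hw' h
  · rintro v w (rfl | ⟨hv, hv'⟩) (rfl | ⟨hw, hw'⟩) h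
    · exact G.irrefl h
    · exact hw.2.2 h.symm
    · exact hv.2.2 h
    · exact hQ1 v w hv hw hv' hw' h
  · rintro v w ⟨hv, hv'⟩ ⟨hw, hw'⟩ h
    exact hQ2 v w hv hw hv' hw' h
  · rintro v w ⟨hvp, hvq, hvr, ⟨a1, a2, a3⟩ | ⟨a1, a2, a3⟩ | ⟨a1, a2, a3⟩⟩
      ⟨hwp, hwq, hwr, ⟨b1, b2, b3⟩ | ⟨b1, b2, b3⟩ | ⟨b1, b2, b3⟩⟩ h
    · exact aux_noK G hK h a1 a2 b1 b2 hpq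
    · exact aux_BB G hW hpq hpr hqr hvr hwq a1 a2 a3 b1 b2 b3 h
    · exact aux_BB G hW hpq.symm hqr hpr hvr hwp a2 a1 a3 b2 b1 b3 h
    · exact aux_BB G hW hpr hpq hqr.symm hvq hwr a1 a3 a2 b1 b3 b2 h
    · exact aux_noK G hK h a1 a3 b1 b3 hpr
    · exact aux_BB G hW hpr.symm hqr.symm hpq hvq hwp a3 a1 a2 b3 b1 b2 h
    · exact aux_BB G hW hqr hpq.symm hpr.symm hvp hwr a2 a3 a1 b2 b3 b1 h
    · exact aux_BB G hW hqr.symm hpr.symm hpq.symm hvp hwq a3 a2 a1 b3 b2 b1 h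
    · exact aux_noK G hK h a2 a3 b2 b3 hqr

/-- The case where every vertex outside the triangle has at most one neighbour in it. -/
theorem aux_case0 {V : Type*} [Finite V] (G : SimpleGraph V)
    (hP : IsEmpty (P3P2 ↪g G)) (hK : G.CliqueFree 4)
    (hPK : IsEmpty (P2K3 ↪g G)) (hH : IsEmpty (hammer ↪g G)) {p q r : V}
    (hpq : G.Adj p q) (hpr : G.Adj p r) (hqr : G.Adj q r)
    (h1 : ∀ u, u ≠ r → G.Adj u p → G.Adj u q → False)
    (h2 : ∀ u, u ≠ q → G.Adj u p → G.Adj u r → False)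
    (h3 : ∀ u, u ≠ p → G.Adj u q → G.Adj u r → False) : G.Colorable 6 := by
  obtain ⟨Q, hQ1, hQ2⟩ := aux_split G (AuxA G r p q) (aux_match G hP hK hpq)
  obtain ⟨R, hR1, hR2⟩ := aux_split G (AuxA G q p r) (aux_match G hP hK hpr)
  obtain ⟨T, hT1, hT2⟩ := aux_split G (AuxA G p q r) (aux_match G hP hK hqr)
  have hD : ∀ v w, (¬ G.Adj v p ∧ ¬ G.Adj v q ∧ ¬ G.Adj v r) →
      (¬ G.Adj w p ∧ ¬ G.Adj w q ∧ ¬ G.Adj w r) → ¬ G.Adj v w := by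
    rintro v w ⟨a, b, c⟩ ⟨d, e, f⟩ h
    exact aux_noPK G hPK h hpq hqr hpr a b c d e f
  have hDA : ∀ v w, (¬ G.Adj v p ∧ ¬ G.Adj v q ∧ ¬ G.Adj v r) → AuxA G p q r w →
      ¬ G.Adj v w := fun v w hv hw => aux_DA G hH hpq hpr hqr hv.1 hv.2.1 hv.2.2 hw
  refine aux_color6 G
    (fun v => v = r ∨ (¬ G.Adj v p ∧ ¬ G.Adj v q ∧ ¬ G.Adj v r) ∨ (AuxA G p q r v ∧ T v))
    (fun v => AuxA G p q r v ∧ ¬ T v)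
    (fun v => v = p ∨ (AuxA G q p r v ∧ R v))
    (fun v => AuxA G q p r v ∧ ¬ R v)
    (fun v => v = q ∨ (AuxA G r p q v ∧ Q v))
    (fun v => AuxA G r p q v ∧ ¬ Q v)
    ?_ ?_ ?_ ?_ ?_ ?_ ?_
  · intro v
    have k1 := h1 v
    have k2 := h2 v
    have k3 := h3 v
    clear h1 h2 h3 hR1 hR2 hT1 hT2 hD hDA hQ1 hQ2
    simp only [AuxA]
    grind
  · rintro v w (rfl | hv | ⟨hv, hv'⟩) (rfl | hw | ⟨hw, hw'⟩) h
    · exact G.irrefl h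
    · exact hw.2.2 h.symm
    · exact hw.2.2 h.symm
    · exact hv.2.2 h
    · exact hD v w hv hw h
    · exact hDA v w hv hw h
    · exact hv.2.2 h
    · exact hDA w v hw hv h.symm
    · exact hT1 v w hv hw hv' hw' h
  · rintro v w ⟨hv, hv'⟩ ⟨hw, hw'⟩ h
    exact hT2 v w hv hw hv' hw' h
  · rintro v w (rfl | ⟨hv, hv'⟩) (rfl | ⟨hw, hw'⟩) h
    · exact G.irrefl h
    · exact hw.2.1 h.symm
    · exact hv.2.1 h
    · exact hR1 v w hv hw hv' hw' h
  · rintro v w ⟨hv, hv'⟩ ⟨hw, hw'⟩ h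
    exact hR2 v w hv hw hv' hw' h
  · rintro v w (rfl | ⟨hv, hv'⟩) (rfl | ⟨hw, hw'⟩) h
    · exact G.irrefl h
    · exact hw.2.2 h.symm
    · exact hv.2.2 h
    · exact hQ1 v w hv hw hv' hw' h
  · rintro v w ⟨hv, hv'⟩ ⟨hw, hw'⟩ h
    exact hQ2 v w hv hw hv' hw' h

theorem stmt19 {V : Type*} [Fintype V] (G : SimpleGraph V)
    (hP : IsEmpty (P3P2 ↪g G)) (hW : IsEmpty (W4 ↪g G)) (hK4 : G.CliqueFree 4)
    (hP2K3 : IsEmpty (P2K3 ↪g G)) (hF1 : IsEmpty (F1 ↪g G)) (hF2 : IsEmpty (F2 ↪g G))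
    (hF3 : IsEmpty (F3 ↪g G)) (hF4 : IsEmpty (F4 ↪g G))
    (hHam : IsEmpty (hammer ↪g G)) (hQ : Nonempty (K1K3 ↪g G)) :
    G.chromaticNumber ≤ 6 := by
  obtain ⟨f⟩ := hQ
  have hpq : G.Adj (f 1) (f 2) := f.map_rel_iff.2 (by simp [K1K3])
  have hqr : G.Adj (f 2) (f 3) := f.map_rel_iff.2 (by simp [K1K3])
  have hpr : G.Adj (f 1) (f 3) := f.map_rel_iff.2 (by simp [K1K3])
  generalize f 1 = p at *
  generalize f 2 = q at *
  generalize f 3 = r at *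
  suffices h : G.Colorable 6 from h.chromaticNumber_le
  by_contra hcol
  refine hcol (aux_case0 G hP hK4 hP2K3 hHam hpq hpr hqr ?_ ?_ ?_)
  · intro u hu a b
    by_cases c : G.Adj u r
    · exact aux_noK G hK4 hpq hpr a.symm hqr b.symm c.symm
    · exact hcol (aux_caseB G hP hW hK4 hP2K3 hHam hpq hpr hqr a b c hu)
  · intro u hu a b
    by_cases c : G.Adj u q
    · exact aux_noK G hK4 hpq hpr a.symm hqr c.symm b.symm
    · exact hcol (aux_caseB G hP hW hK4 hP2K3 hHam hpr hpq hqr.symm a b c hu)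
  · intro u hu a b
    by_cases c : G.Adj u p
    · exact aux_noK G hK4 hpq hpr c.symm hqr a.symm b.symm
    · exact hcol (aux_caseB G hP hW hK4 hP2K3 hHam hqr hpq.symm hpr.symm a b c hu)
end
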